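/- For each prime g ≥ 5 and every ε > 0 there exists a constant C = C(g, ε) such that for all real X ≥ 2, the sum of h_g(-d)^2 over squarefree integers d with 0 < d < X is at most C · X^{2 - 3/(g+1) + ε}. -/

import Mathlib

/-- The imaginary quadratic field `ℚ(√-d)`, realized as the subfield of `ℂ`
generated over `ℚ` by `√d · i`. -/
noncomputable def Kneg (d : ℕ) : IntermediateField ℚ ℂ :=
  IntermediateField.adjoin ℚ {(Real.sqrt d : ℂ) * Complex.I}

/-- `hneg g d` is the `g`-part of the class number of `ℚ(√-d)`: the number of
ideal classes `c` of the ring of integers of `ℚ(√-d)` with `c ^ g = 1`. -/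
noncomputable def hneg (g d : ℕ) : ℕ :=
  Nat.card {c : ClassGroup (NumberField.RingOfIntegers (Kneg d)) // c ^ g = 1}

theorem add_one_pow_le_mul_two_pow (k : ℕ) :
    ∃ C : ℕ, 1 ≤ C ∧ ∀ a : ℕ, (a + 1) ^ k ≤ C * 2 ^ a := by
  have h := tendsto_pow_const_div_const_pow_of_one_lt k (r := (2 : ℝ)) (by norm_num)
  obtain ⟨B, hB⟩ := h.bddAbove_range
  refine ⟨⌈2 * B⌉₊ + 1, by omega, fun a => ?_⟩
  have h1 : (((a + 1 : ℕ) : ℝ)) ^ k / 2 ^ (a + 1) ≤ B := hB ⟨a + 1, rfl⟩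
  rw [div_le_iff₀ (by positivity)] at h1
  have h2 : (2 * B : ℝ) ≤ ⌈2 * B⌉₊ := Nat.le_ceil _
  have h3 : (0 : ℝ) < 2 ^ a := by positivity
  have : (((a + 1 : ℕ) : ℝ)) ^ k ≤ ((⌈2 * B⌉₊ + 1 : ℕ) : ℝ) * 2 ^ a := by
    rw [pow_succ] at h1
    push_cast at *
    nlinarith
  exact_mod_cast this

/-- The divisor bound: `τ(n) ≪ n ^ (1 / k)` for every `k`. -/
theorem card_divisors_pow_le (k : ℕ) :
    ∃ C : ℕ, 1 ≤ C ∧ ∀ n : ℕ, n ≠ 0 → n.divisors.card ^ k ≤ C * n := by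
  obtain ⟨C, hC1, hC⟩ := add_one_pow_le_mul_two_pow k
  refine ⟨C ^ 2 ^ k, Nat.one_le_pow _ _ hC1, fun n hn => ?_⟩
  have hlocal : ∀ p ∈ n.primeFactors, (n.factorization p + 1) ^ k ≤
      (if p < 2 ^ k then C else 1) * p ^ n.factorization p := by
    intro p hp
    have hp2 := (Nat.prime_of_mem_primeFactors hp).two_le
    split_ifs with h
    · exact (hC _).trans (Nat.mul_le_mul_left _ (Nat.pow_le_pow_left hp2 _))
    · rw [one_mul]
      calc (n.factorization p + 1) ^ k ≤ (2 ^ n.factorization p) ^ k :=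
            Nat.pow_le_pow_left (Nat.lt_two_pow_self) _
        _ = (2 ^ k) ^ n.factorization p := by rw [← pow_mul, ← pow_mul, mul_comm]
        _ ≤ _ := Nat.pow_le_pow_left (not_lt.mp h) _
  rw [Nat.card_divisors hn, ← Finset.prod_pow]
  calc _ ≤ _ := Finset.prod_le_prod' hlocal
    _ = (∏ p ∈ n.primeFactors, if p < 2 ^ k then C else 1) * n := by
        rw [Finset.prod_mul_distrib]
        congr 1
        exact Nat.prod_factorization_pow_eq_self hn
    _ ≤ C ^ 2 ^ k * n := by
        gcongr
        rw [← Finset.prod_filter, Finset.prod_const]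
        refine Nat.pow_le_pow_right hC1 ?_
        calc _ ≤ (Finset.range (2 ^ k)).card := Finset.card_le_card fun p hp => by
              simpa using (Finset.mem_filter.mp hp).2
          _ = _ := Finset.card_range _

/-- There are at least `P ^ (1 - 1 / A)` primes up to `P`, up to a constant. -/
theorem pow_le_mul_primeCounting_pow (A : ℕ) :
    ∃ C : ℕ, 1 ≤ C ∧ ∀ P : ℕ, 2 ≤ P → P ^ A ≤ C * P * P.primeCounting ^ A := by
  have hlog : (fun x : ℝ => Real.log x ^ A) =O[Filter.atTop] (fun x : ℝ => x) :=
    Real.isLittleO_pow_log_id_atTop.isBigO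
  obtain ⟨c, hc⟩ := hlog.bound
  obtain ⟨x₀, hx₀⟩ := Filter.eventually_atTop.mp hc
  set N := ⌈max x₀ 100⌉₊ with hN
  have hcheb : ∀ P : ℕ, 100 ≤ P → (P : ℝ) ≤ 4 * (P.primeCounting * Real.log P) := by
    intro P hP
    have h1 := Chebyshev.psi_ge P
    have h2 := Chebyshev.psi_le_primeCounting_mul_log P
    have h3 := Real.log_two_gt_d9
    have h4 : Real.log (P + 1) ≤ P / 10 := by
      have h5 : Real.log (((P : ℝ) + 1) / 20) ≤ ((P : ℝ) + 1) / 20 - 1 :=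
        Real.log_le_sub_one_of_pos (by positivity)
      rw [Real.log_div (by positivity) (by norm_num)] at h5
      have h6 : Real.log 20 ≤ 5 * Real.log 2 := by
        rw [← Real.log_rpow (by norm_num)]
        exact Real.log_le_log (by norm_num) (by norm_num)
      have h7 := Real.log_two_lt_d9
      have h8 : (100 : ℝ) ≤ P := by exact_mod_cast hP
      linarith
    nlinarith
  refine ⟨N ^ A + ⌈4 ^ A * c⌉₊, ?_, fun P hP => ?_⟩
  · have : 1 ≤ N := Nat.one_le_iff_ne_zero.mpr (by
      rw [hN, Ne, Nat.ceil_eq_zero]; have := le_max_right x₀ 100; linarith)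
    have := Nat.one_le_pow A N this
    omega
  have hpi : 1 ≤ P.primeCounting := by
    have : Nat.primeCounting 2 ≤ P.primeCounting := Nat.monotone_primeCounting hP
    have h2 : Nat.primeCounting 2 = 1 := by decide
    omega
  rcases le_total P N with h | h
  · calc P ^ A ≤ N ^ A := Nat.pow_le_pow_left h _
      _ ≤ (N ^ A + ⌈4 ^ A * c⌉₊) := by omega
      _ ≤ (N ^ A + ⌈4 ^ A * c⌉₊) * (P * P.primeCounting ^ A) :=
          Nat.le_mul_of_pos_right _ (by positivity)
      _ = _ := by ring
  · have h0 : max x₀ 100 ≤ (P : ℝ) := (Nat.le_ceil _).trans (by exact_mod_cast h)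
    have h1 := hx₀ P ((le_max_left _ _).trans h0)
    have h100 : 100 ≤ P := by exact_mod_cast (le_max_right _ _).trans h0
    have hlp : 0 ≤ Real.log P := Real.log_natCast_nonneg P
    rw [Real.norm_of_nonneg (by positivity), Real.norm_of_nonneg (by positivity)] at h1
    have h2 : (4 ^ A * c : ℝ) ≤ ⌈4 ^ A * c⌉₊ := Nat.le_ceil _
    have : ((P : ℝ)) ^ A ≤ ((N ^ A + ⌈4 ^ A * c⌉₊ : ℕ) : ℝ) * P * (P.primeCounting : ℝ) ^ A := by
      calc ((P : ℝ)) ^ A ≤ (4 * (P.primeCounting * Real.log P)) ^ A :=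
            pow_le_pow_left₀ (by positivity) (hcheb P h100) _
        _ = 4 ^ A * Real.log P ^ A * (P.primeCounting : ℝ) ^ A := by rw [mul_pow, mul_pow]; ring
        _ ≤ 4 ^ A * (c * P) * (P.primeCounting : ℝ) ^ A := by gcongr
        _ = (4 ^ A * c) * P * (P.primeCounting : ℝ) ^ A := by ring
        _ ≤ _ := by
          gcongr
          push_cast
          have : (0 : ℝ) ≤ (N : ℝ) ^ A := by positivity
          linarith
    exact_mod_cast this

/-- Cauchy–Schwarz for the fibres of a map into a finite type. -/
theorem sq_card_le_card_mul_card_pairs {ι β : Type*} [DecidableEq β] (A : Finset ι) (B : Finset β)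
    (f : ι → β) (hf : ∀ a ∈ A, f a ∈ B) :
    A.card ^ 2 ≤ B.card * ((A ×ˢ A).filter fun x => f x.1 = f x.2).card := by
  have h1 := Finset.card_eq_sum_card_fiberwise hf
  have h2 : ((A ×ˢ A).filter fun x => f x.1 = f x.2).card
      = ∑ b ∈ B, (A.filter fun a => f a = b).card ^ 2 := by
    rw [Finset.card_eq_sum_card_fiberwise (f := fun x => f x.1) (t := B)]
    · refine Finset.sum_congr rfl fun b _ => ?_
      rw [sq, ← Finset.card_product]
      congr 1
      ext x
      simp only [Finset.mem_filter, Finset.mem_product]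
      constructor
      · rintro ⟨⟨⟨h1, h2⟩, h3⟩, h4⟩
        exact ⟨⟨h1, h4⟩, h2, h3 ▸ h4⟩
      · rintro ⟨⟨h1, h4⟩, h2, h3⟩
        exact ⟨⟨⟨h1, h2⟩, h4.trans h3.symm⟩, h4⟩
    · intro x hx
      simp only [Finset.coe_filter, Finset.mem_product, Set.mem_ofPred_eq] at hx
      exact hf _ hx.1.1
  rw [h2, h1]
  exact sq_sum_le_card_mul_sum_sq

theorem card_torsion_mul_card_range_pow {G : Type*} [CommGroup G] [Finite G] (g : ℕ) :
    Nat.card {c : G // c ^ g = 1} * Nat.card (powMonoidHom g : G →* G).range = Nat.card G := by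
  have h := Subgroup.card_eq_card_quotient_mul_card_subgroup (powMonoidHom g : G →* G).ker
  rw [h, mul_comm, Nat.card_congr (QuotientGroup.quotientKerEquivRange
    (powMonoidHom g : G →* G)).toEquiv]
  rfl

theorem card_le_of_pairwise_dvd_sub (U : Finset ℕ) (m : ℕ) (hm : 0 < m) (Δ : ℝ) (hΔ : 0 ≤ Δ)
    (hd : ∀ u ∈ U, ∀ w ∈ U, (w : ℝ) - u ≤ Δ)
    (hc : ∀ u ∈ U, ∀ w ∈ U, (m : ℤ) ∣ (w : ℤ) - u) :
    (U.card : ℝ) ≤ Δ / m + 1 := by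
  rcases U.eq_empty_or_nonempty with rfl | hne
  · simp; positivity
  set a := U.min' hne with ha
  have haU : a ∈ U := U.min'_mem hne
  have hle : ∀ u ∈ U, a ≤ u := fun u hu => U.min'_le u hu
  have hm' : (0 : ℝ) < m := by exact_mod_cast hm
  have hcard : U.card ≤ (Finset.range (⌊Δ / m⌋₊ + 1)).card := by
    refine Finset.card_le_card_of_injOn (fun u => (u - a) / m) ?_ ?_
    · intro u hu
      simp only [Finset.coe_range, Set.mem_Iio]
      rw [Nat.lt_succ_iff]
      refine Nat.le_floor ((Nat.cast_div_le).trans ?_)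
      gcongr
      rw [Nat.cast_sub (hle u hu)]
      exact hd a haU u hu
    · intro u hu w hw h
      have h1 : m ∣ u - a := by
        have := hc a haU u hu
        rw [← Nat.cast_sub (hle u hu)] at this
        exact_mod_cast this
      have h2 : m ∣ w - a := by
        have := hc a haU w hw
        rw [← Nat.cast_sub (hle w hw)] at this
        exact_mod_cast this
      have h3 := Nat.div_mul_cancel h1
      have h4 := Nat.div_mul_cancel h2
      simp only at h
      rw [h, h4] at h3
      have := hle u hu
      have := hle w hw
      omega
  rw [Finset.card_range] at hcard
  calc (U.card : ℝ) ≤ ((⌊Δ / m⌋₊ + 1 : ℕ) : ℝ) := by exact_mod_cast hcard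
    _ ≤ _ := by push_cast; gcongr; exact Nat.floor_le (by positivity)

theorem dvd_four_of_sq_dvd {e u M : ℤ} (h1 : e ∣ 2 * u) (h2 : e ^ 2 ∣ 4 * M - u ^ 2)
    (hc : IsCoprime e M) : e ∣ 4 := by
  have h3 : e ^ 2 ∣ 16 * M := by
    have : 16 * M = 4 * (4 * M - u ^ 2) + (2 * u) ^ 2 := by ring
    rw [this]
    exact dvd_add (h2.mul_left _) (pow_dvd_pow_of_dvd h1 2)
  have h4 : e ^ 2 ∣ 4 ^ 2 := by
    have := (hc.pow_left (m := 2)).dvd_of_dvd_mul_right h3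
    norm_num at this ⊢
    exact this
  exact (Int.pow_dvd_pow_iff two_ne_zero).mp h4

theorem card_sqrt_mod_sq_le (M v : ℕ) (hv : 0 < v) (hcop : v.Coprime M) (U : Finset ℕ)
    (Δ : ℝ) (hΔ : 0 ≤ Δ) (hd : ∀ u ∈ U, ∀ w ∈ U, (w : ℝ) - u ≤ Δ)
    (hc : ∀ u ∈ U, ((v : ℤ) ^ 2) ∣ 4 * M - (u : ℤ) ^ 2) :
    (U.card : ℝ) ≤ (v ^ 2).divisors.card * (4 * Δ / v ^ 2 + 1) := by
  rcases U.eq_empty_or_nonempty with rfl | ⟨u₀, hu₀⟩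
  · simp; positivity
  have hv2 : 0 < v ^ 2 := by positivity
  set f : ℕ → ℕ := fun u => Int.gcd ((v ^ 2 : ℕ) : ℤ) ((u : ℤ) - u₀) with hf
  have hmaps : ∀ u ∈ U, f u ∈ (v ^ 2).divisors := by
    intro u _
    rw [Nat.mem_divisors]
    refine ⟨?_, hv2.ne'⟩
    exact Int.natCast_dvd_natCast.mp (Int.gcd_dvd_left _ _)
  rw [Finset.card_eq_sum_card_fiberwise hmaps]
  push_cast
  calc _ ≤ ∑ _a ∈ (v ^ 2).divisors, (4 * Δ / v ^ 2 + 1) := Finset.sum_le_sum fun a ha => ?_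
    _ = _ := by rw [Finset.sum_const, nsmul_eq_mul]
  obtain ⟨b, hab⟩ := (Nat.mem_divisors.mp ha).1
  have hapos : 0 < a := Nat.pos_of_mem_divisors ha
  have hbpos : 0 < b := Nat.pos_of_ne_zero (by rintro rfl; omega)
  rcases (U.filter fun u => f u = a).eq_empty_or_nonempty with he | ⟨u₁, hu₁⟩
  · rw [he]; simp; positivity
  have key : ∀ u ∈ U.filter (fun u => f u = a), (a : ℤ) ∣ (u : ℤ) - u₀ ∧ (b : ℤ) ∣ (u : ℤ) + u₀ := by
    intro u hu
    obtain ⟨huU, hua⟩ := Finset.mem_filter.mp hu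
    have h1 : (a : ℤ) ∣ (u : ℤ) - u₀ := hua ▸ Int.gcd_dvd_right _ _
    refine ⟨h1, ?_⟩
    obtain ⟨t, ht⟩ := h1
    have hprod : ((v : ℤ) ^ 2) ∣ ((u : ℤ) - u₀) * (u + u₀) := by
      have h2 : ((u : ℤ) - u₀) * (u + u₀) = (4 * M - (u₀ : ℤ) ^ 2) - (4 * M - (u : ℤ) ^ 2) := by
        ring
      exact h2 ▸ dvd_sub (hc u₀ hu₀) (hc u huU)
    have hab' : (v : ℤ) ^ 2 = a * b := by exact_mod_cast hab
    have hcopbt : IsCoprime (b : ℤ) t := by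
      rw [Int.isCoprime_iff_gcd_eq_one]
      have h2 : Int.gcd ((v ^ 2 : ℕ) : ℤ) ((u : ℤ) - u₀) = a := hua
      rw [ht, hab, Nat.cast_mul, Int.gcd_mul_left, Int.natAbs_natCast] at h2
      exact Nat.eq_of_mul_eq_mul_left hapos (by rw [h2, mul_one])
    rw [hab', ht, mul_assoc] at hprod
    have h3 := (mul_dvd_mul_iff_left (by exact_mod_cast hapos.ne')).mp hprod
    exact hcopbt.dvd_of_dvd_mul_left h3
  have hgcd : Nat.gcd a b ∣ 4 := by
    have hsq : Nat.gcd a b ∣ v := by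
      have : (Nat.gcd a b) ^ 2 ∣ v ^ 2 := by
        rw [hab, sq]; exact mul_dvd_mul (Nat.gcd_dvd_left _ _) (Nat.gcd_dvd_right _ _)
      exact (Nat.pow_dvd_pow_iff two_ne_zero).mp this
    have h1 := key u₁ hu₁
    have h2 : ((Nat.gcd a b : ℕ) : ℤ) ∣ 2 * u₀ := by
      have ha' : ((Nat.gcd a b : ℕ) : ℤ) ∣ a := by exact_mod_cast Nat.gcd_dvd_left a b
      have hb' : ((Nat.gcd a b : ℕ) : ℤ) ∣ b := by exact_mod_cast Nat.gcd_dvd_right a b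
      have h3 : (2 * u₀ : ℤ) = ((u₁ : ℤ) + u₀) - ((u₁ : ℤ) - u₀) := by ring
      exact h3 ▸ dvd_sub (hb'.trans h1.2) (ha'.trans h1.1)
    have h3 : ((Nat.gcd a b : ℕ) : ℤ) ^ 2 ∣ 4 * M - (u₀ : ℤ) ^ 2 :=
      (pow_dvd_pow_of_dvd (by exact_mod_cast hsq) 2).trans (hc u₀ hu₀)
    have h4 : IsCoprime ((Nat.gcd a b : ℕ) : ℤ) (M : ℤ) :=
      Nat.isCoprime_iff_coprime.mpr (hcop.coprime_dvd_left hsq)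
    exact_mod_cast dvd_four_of_sq_dvd h2 h3 h4
  have hlcm : (v : ℝ) ^ 2 ≤ 4 * (Nat.lcm a b : ℕ) := by
    have h1 := Nat.gcd_mul_lcm a b
    have h2 : Nat.gcd a b ≤ 4 := Nat.le_of_dvd (by norm_num) hgcd
    have h3 : v ^ 2 ≤ 4 * Nat.lcm a b := by
      rw [hab, ← h1]; exact Nat.mul_le_mul_right _ h2
    exact_mod_cast h3
  have hlpos : 0 < Nat.lcm a b := Nat.lcm_pos hapos hbpos
  refine (card_le_of_pairwise_dvd_sub _ (Nat.lcm a b) hlpos Δ hΔ ?_ ?_).trans ?_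
  · intro u hu w hw
    exact hd u (Finset.mem_filter.mp hu).1 w (Finset.mem_filter.mp hw).1
  · intro u hu w hw
    have h1 := key u hu
    have h2 := key w hw
    rw [Int.natCast_dvd]
    refine Nat.lcm_dvd ?_ ?_
    · rw [← Int.natCast_dvd]
      have := dvd_sub h2.1 h1.1
      simpa using this
    · rw [← Int.natCast_dvd]
      have := dvd_sub h2.2 h1.2
      simpa using this
  · gcongr ?_ + 1
    have hl' : (0 : ℝ) < (Nat.lcm a b : ℕ) := by exact_mod_cast hlpos
    have hv' : (0 : ℝ) < v := by exact_mod_cast hv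
    rw [div_le_div_iff₀ hl' (by positivity)]
    nlinarith

/-- For fixed `M`, a bound for the number of `d` of size about `D` such that `4 M` is represented
by `u ^ 2 + d v ^ 2` with `v` nonzero and coprime to `M`. -/
theorem card_represented_le (M D D' τ : ℕ) (hM : 0 < M) (hD : 0 < D)
    (hτ : ∀ v : ℕ, 0 < v → v ^ 2 ≤ 4 * M → (v ^ 2).divisors.card ≤ τ) (T : Finset ℕ)
    (hT : ∀ d ∈ T, D ≤ d ∧ d ≤ D' ∧
      ∃ u v : ℕ, 0 < v ∧ v.Coprime M ∧ u ^ 2 + d * v ^ 2 = 4 * M) :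
    (T.card : ℝ) ≤ τ * (4 * D' / √D + 2 * √M / √D) := by
  classical
  have hM' : (0 : ℝ) < √M := Real.sqrt_pos.mpr (by exact_mod_cast hM)
  have hMsq : √M ^ 2 = (M : ℝ) := Real.sq_sqrt (by positivity)
  have hD' : (0 : ℝ) < √D := Real.sqrt_pos.mpr (by exact_mod_cast hD)
  have hDsq : √D ^ 2 = (D : ℝ) := Real.sq_sqrt (by positivity)
  set V := Finset.Icc 1 ⌊2 * √M / √D⌋₊ with hV
  let U : ℕ → Finset ℕ := fun v => (Finset.range (4 * M + 1)).filter fun u =>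
    v.Coprime M ∧ ∃ d ∈ T, u ^ 2 + d * v ^ 2 = 4 * M
  have hU : ∀ v ∈ V, ((U v).card : ℝ) ≤ τ * (2 * D' / √M + 1) := by
    intro v hv
    have hvpos : 0 < v := (Finset.mem_Icc.mp hv).1
    have hv0 : (0 : ℝ) < v := by exact_mod_cast hvpos
    rcases (U v).eq_empty_or_nonempty with he | ⟨u₀, hu₀⟩
    · rw [he]; simp; positivity
    have hvM : v.Coprime M := (Finset.mem_filter.mp hu₀).2.1
    have hlow : ∀ u ∈ U v, (2 * √M - u ≤ D' * v ^ 2 / (2 * √M)) ∧ (u : ℝ) ≤ 2 * √M := by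
      intro u hu
      obtain ⟨-, -, d, hd, heq⟩ := Finset.mem_filter.mp hu
      have heq' : (u : ℝ) ^ 2 + d * v ^ 2 = 4 * M := by exact_mod_cast heq
      have hdD : (d : ℝ) ≤ D' := by exact_mod_cast (hT d hd).2.1
      have hu0 : (0 : ℝ) ≤ u := by positivity
      have hd0 : (0 : ℝ) ≤ d := by positivity
      have hle : (u : ℝ) ≤ 2 * √M := by
        apply le_of_sq_le_sq _ (by positivity)
        nlinarith [sq_nonneg (v : ℝ), mul_nonneg hd0 (sq_nonneg (v : ℝ))]
      refine ⟨?_, hle⟩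
      rw [le_div_iff₀ (by positivity)]
      have : (d : ℝ) * v ^ 2 ≤ D' * v ^ 2 := by gcongr
      nlinarith
    have h := card_sqrt_mod_sq_le M v hvpos hvM (U v) (D' * v ^ 2 / (2 * √M)) (by positivity)
      (fun u hu w hw => by linarith [(hlow u hu).1, (hlow w hw).2]) (fun u hu => by
        obtain ⟨-, -, d, hd, heq⟩ := Finset.mem_filter.mp hu
        refine ⟨d, ?_⟩
        have heq' : (u : ℤ) ^ 2 + d * v ^ 2 = 4 * M := by exact_mod_cast heq
        linarith)
    refine h.trans ?_
    have hsmall : v ^ 2 ≤ 4 * M := by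
      obtain ⟨-, -, d, hd, heq⟩ := Finset.mem_filter.mp hu₀
      have : 1 ≤ d := hD.trans_le (hT d hd).1
      nlinarith
    have h1 : 4 * ((D' : ℝ) * v ^ 2 / (2 * √M)) / v ^ 2 + 1 = 2 * D' / √M + 1 := by
      field_simp; ring
    rw [h1]
    gcongr
    exact hτ v hvpos hsmall
  have hcover : T.card ≤ ∑ v ∈ V, (U v).card := by
    rw [← Finset.card_sigma]
    choose! u v hvpos hcop heq using fun d (hd : d ∈ T) => (hT d hd).2.2
    refine Finset.card_le_card_of_injOn (fun d => (⟨v d, u d⟩ : Σ _ : ℕ, ℕ)) ?_ ?_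
    · intro d hd
      have hd : d ∈ T := hd
      have heq1 := heq d hd
      simp only [Finset.coe_sigma, Set.mem_sigma_iff, Finset.mem_coe]
      refine ⟨?_, ?_⟩
      · rw [hV, Finset.mem_Icc]
        refine ⟨hvpos d hd, Nat.le_floor ?_⟩
        rw [le_div_iff₀ hD']
        apply le_of_sq_le_sq _ (by positivity)
        have heq' : (u d : ℝ) ^ 2 + d * v d ^ 2 = 4 * M := by exact_mod_cast heq1
        have hdD : (D : ℝ) ≤ d := by exact_mod_cast (hT d hd).1
        have : (D : ℝ) * v d ^ 2 ≤ d * v d ^ 2 := by gcongr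
        nlinarith [sq_nonneg (u d : ℝ)]
      · refine Finset.mem_filter.mpr ⟨Finset.mem_range.mpr ?_, hcop d hd, d, hd, heq1⟩
        nlinarith
    · intro d hd e he h
      have hd : d ∈ T := hd
      have he : e ∈ T := he
      simp only [Sigma.mk.injEq, heq_eq_eq] at h
      have h1 := heq d hd
      have h2 := heq e he
      rw [h.1, h.2] at h1
      have : 0 < v e ^ 2 := by have := hvpos e he; positivity
      have h3 : d * v e ^ 2 = e * v e ^ 2 := by omega
      exact Nat.eq_of_mul_eq_mul_right this h3
  calc (T.card : ℝ) ≤ ∑ v ∈ V, ((U v).card : ℝ) := by exact_mod_cast hcover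
    _ ≤ ∑ _v ∈ V, (τ * (2 * D' / √M + 1) : ℝ) := Finset.sum_le_sum hU
    _ = ⌊2 * √M / √D⌋₊ * (τ * (2 * D' / √M + 1)) := by
        rw [Finset.sum_const, nsmul_eq_mul, hV, Nat.card_Icc]; simp
    _ ≤ (2 * √M / √D) * (τ * (2 * D' / √M + 1)) := by
        gcongr; exact Nat.floor_le (by positivity)
    _ = _ := by field_simp; ring

/-- The integer `x` is a nonzero quadratic residue modulo `p`. -/
def IsResidue (p : ℕ) (x : ℤ) : Prop := (x : ZMod p) ≠ 0 ∧ IsSquare (x : ZMod p)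

open Classical in
/-- `1` at the nonzero quadratic residues modulo `p`, and `-1` elsewhere. -/
noncomputable def residueSign (p : ℕ) (x : ℤ) : ℝ := if IsResidue p x then 1 else -1

theorem residueSign_mul_self (p : ℕ) (x : ℤ) : residueSign p x * residueSign p x = 1 := by
  unfold residueSign; split_ifs <;> norm_num

theorem abs_residueSign (p : ℕ) (x : ℤ) : |residueSign p x| = 1 := by
  unfold residueSign; split_ifs <;> norm_num

theorem ZMod.sum_eq_sum_range {p : ℕ} [NeZero p] {A : Type*} [AddCommMonoid A] (f : ZMod p → A) :
    ∑ t, f t = ∑ t ∈ Finset.range p, f (t : ZMod p) := by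
  refine Finset.sum_bij' (fun t _ => t.val) (fun t _ => (t : ZMod p)) ?_ ?_ ?_ ?_ ?_
  · intro t _; exact Finset.mem_range.mpr (ZMod.val_lt t)
  · intro t _; exact Finset.mem_univ _
  · intro t _; simp
  · intro t ht; exact ZMod.val_cast_of_lt (Finset.mem_range.mp ht)
  · intro t _; simp

open ComplexConjugate in
theorem exists_fourier_residueSign (p : ℕ) (hp : p.Prime) (hp2 : 2 < p) :
    ∃ (c : ℕ → ℂ) (e : ℕ → ℤ → ℂ), (∀ t, ‖c t‖ ≤ 2 / √p) ∧
      (∀ x : ℤ, (residueSign p x : ℂ) = ∑ t ∈ Finset.range p, c t * e t x) ∧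
      (∀ t x y, e t (x - y) = e t x * conj (e t y)) ∧
      (∀ x : ℤ, ∑ t ∈ Finset.range p, e t x = if (p : ℤ) ∣ x then (p : ℂ) else 0) := by
  have : Fact p.Prime := ⟨hp⟩
  have hcharne : ringChar (ZMod p) ≠ 2 := by rw [ZMod.ringChar_zmod_n]; omega
  obtain ⟨ψ, hψ⟩ : ∃ ψ : AddChar (ZMod p) ℂ, ψ.IsPrimitive := ⟨_, ZMod.isPrimitive_stdAddChar p⟩
  set χ : MulChar (ZMod p) ℂ := (quadraticChar (ZMod p)).ringHomComp (Int.castRingHom ℂ) with hχ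
  have hχq : χ.IsQuadratic := (quadraticChar_isQuadratic (ZMod p)).comp _
  have hχ1 : χ ≠ 1 := by
    intro h
    obtain ⟨a, ha⟩ := quadraticChar_exists_neg_one hcharne
    have ha0 : IsUnit a := by
      by_contra hu
      rw [MulChar.map_nonunit _ hu] at ha; norm_num at ha
    have h1 : χ a = 1 := by rw [h, MulChar.one_apply ha0]
    rw [hχ, MulChar.ringHomComp_apply, ha] at h1
    norm_num at h1
  set G := gaussSum χ ψ with hG
  have hGsq : G ^ 2 = χ (-1) * (p : ℂ) := by
    have := gaussSum_sq hχ1 hχq hψ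
    rwa [ZMod.card] at this
  have hp0 : (0 : ℝ) < p := by exact_mod_cast hp.pos
  have hsp : (0 : ℝ) < √p := Real.sqrt_pos.mpr hp0
  have hχnorm : ∀ a, ‖χ a‖ ≤ 1 := fun a => by
    rcases hχq a with h | h | h <;> rw [h] <;> simp
  have hχm1 : ‖χ (-1)‖ = 1 := by
    have h := hχq (-1)
    have hne : χ (-1) ≠ 0 := (IsUnit.neg isUnit_one).map χ |>.ne_zero
    rcases h with h | h | h
    · exact absurd h hne
    · rw [h]; simp
    · rw [h]; simp
  have hGnorm : ‖G‖ = √p := by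
    have h1 : ‖G‖ ^ 2 = p := by rw [← norm_pow, hGsq, norm_mul, hχm1]; simp
    rw [← h1, Real.sqrt_sq (norm_nonneg _)]
  have hG0 : G ≠ 0 := by rw [← norm_pos_iff, hGnorm]; exact hsp
  have hψsum : ∀ y : ZMod p, ∑ t, ψ (t * y) = if y = 0 then (p : ℂ) else 0 := by
    intro y
    have := AddChar.sum_mulShift y hψ
    rw [ZMod.card] at this
    rw [this]
    split_ifs <;> simp
  have hψrange : ∀ x : ℤ, ∑ t ∈ Finset.range p, ψ ((t : ZMod p) * (x : ZMod p)) =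
      if (p : ℤ) ∣ x then (p : ℂ) else 0 := by
    intro x
    rw [← ZMod.sum_eq_sum_range (fun t : ZMod p => ψ (t * (x : ZMod p))), hψsum]
    simp only [ZMod.intCast_zmod_eq_zero_iff_dvd]
  have hχsum : ∀ y : ZMod p, ∑ t, χ t * ψ (t * y) = χ y * G := by
    intro y
    by_cases hy : y = 0
    · subst hy
      simp only [mul_zero, AddChar.map_zero_eq_one, mul_one]
      rw [MulChar.sum_eq_zero_of_ne_one hχ1, MulChar.map_nonunit _ not_isUnit_zero, zero_mul]
    · have h := gaussSum_mulShift χ ψ (Units.mk0 y hy)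
      rw [Units.val_mk0] at h
      have h2 : χ y * χ y = 1 := by
        rw [← map_mul]
        have hne : χ y ≠ 0 := ((Units.mk0 y hy).isUnit.map χ).ne_zero
        rw [map_mul]
        rcases hχq y with h | h | h
        · exact absurd h hne
        · rw [h]; simp
        · rw [h]; simp
      rw [← hG] at h
      rw [← h, ← mul_assoc, h2, one_mul]
      unfold gaussSum
      refine Finset.sum_congr rfl fun t _ => ?_
      rw [AddChar.mulShift_apply, mul_comm y t]
  refine ⟨fun t => χ t / G - 1 / p, fun t x => ψ ((t : ZMod p) * (x : ZMod p)), ?_, ?_, ?_, ?_⟩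
  · intro t
    refine (norm_sub_le _ _).trans ?_
    rw [norm_div, norm_div, hGnorm, norm_one, Complex.norm_natCast]
    have h1 : ‖χ (t : ZMod p)‖ / √p ≤ 1 / √p := by gcongr; exact hχnorm _
    have h2 : 1 / (p : ℝ) ≤ 1 / √p := by
      gcongr
      rw [Real.sqrt_le_left hp0.le]
      have : (1 : ℝ) ≤ p := by exact_mod_cast hp.one_le
      nlinarith
    calc _ ≤ 1 / √p + 1 / √p := add_le_add h1 h2
      _ = _ := by ring
  · intro x
    refine Eq.trans ?_ (ZMod.sum_eq_sum_range
      (fun t : ZMod p => (χ t / G - 1 / p) * ψ (t * (x : ZMod p))))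
    have h2 : ∑ t, (χ t / G - 1 / p) * ψ (t * (x : ZMod p))
        = (∑ t, χ t * ψ (t * (x : ZMod p))) / G - (∑ t, ψ (t * (x : ZMod p))) / p := by
      rw [Finset.sum_div, Finset.sum_div, ← Finset.sum_sub_distrib]
      refine Finset.sum_congr rfl fun t _ => ?_
      ring
    rw [h2, hχsum, hψsum, mul_div_cancel_right₀ _ hG0]
    unfold residueSign IsResidue
    by_cases hx : (x : ZMod p) = 0
    · have hpc : (p : ℂ) ≠ 0 := by exact_mod_cast hp.ne_zero
      simp [hx, hpc, MulChar.map_nonunit]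
    · rw [if_neg hx]
      by_cases hsq : IsSquare (x : ZMod p)
      · rw [hχ, MulChar.ringHomComp_apply, (quadraticChar_one_iff_isSquare hx).mpr hsq]
        simp [hx, hsq]
      · rw [hχ, MulChar.ringHomComp_apply, quadraticChar_neg_one_iff_not_isSquare.mpr hsq]
        simp [hsq]
  · intro t x y
    have h : ψ (-((t : ZMod p) * (y : ZMod p))) = conj (ψ ((t : ZMod p) * (y : ZMod p))) := by
      rw [AddChar.map_neg_eq_conj]
    rw [← h, ← AddChar.map_add_eq_mul]
    push_cast
    ring_nf
  · intro x
    exact hψrange x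

theorem card_pairs_mod_le (W : Finset ℕ) (hW : ∀ p ∈ W, p.Prime) (Y : ℕ) :
    (((Finset.range Y ×ˢ Finset.range Y).filter
      fun x => ∀ p ∈ W, (p : ℤ) ∣ (x.1 : ℤ) - x.2).card : ℝ) * ∏ p ∈ W, (p : ℝ)
      ≤ Y ^ 2 + Y * ∏ p ∈ W, (p : ℝ) := by
  set L := ∏ p ∈ W, p with hL
  have hLpos : 0 < L := Finset.prod_pos fun p hp => (hW p hp).pos
  have hdvd : ∀ z : ℤ, (∀ p ∈ W, (p : ℤ) ∣ z) → (L : ℤ) ∣ z := by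
    intro z hz
    rw [Int.natCast_dvd]
    refine Finset.prod_primes_dvd _ (fun p hp => (hW p hp).prime) fun p hp => ?_
    exact Int.natCast_dvd.mp (hz p hp)
  have hfib : ∀ a ∈ Finset.range Y, (((Finset.range Y).filter
      fun b : ℕ => ∀ p ∈ W, (p : ℤ) ∣ (a : ℤ) - b).card : ℝ) ≤ Y / L + 1 := by
    intro a _
    refine card_le_of_pairwise_dvd_sub _ L hLpos Y (by positivity) ?_ ?_
    · intro u _ w hw
      have h1 : w < Y := Finset.mem_range.mp (Finset.mem_filter.mp hw).1
      have h2 : (w : ℝ) < Y := by exact_mod_cast h1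
      have h3 : (0 : ℝ) ≤ u := by positivity
      linarith
    · intro u hu w hw
      refine hdvd _ fun p hp => ?_
      have := dvd_sub ((Finset.mem_filter.mp hu).2 p hp) ((Finset.mem_filter.mp hw).2 p hp)
      have h3 : (w : ℤ) - u = ((a : ℤ) - u) - (a - w) := by ring
      rwa [h3]
  have hL0 : (0 : ℝ) < L := by exact_mod_cast hLpos
  have hcast : ∏ p ∈ W, (p : ℝ) = L := by rw [hL]; push_cast; rfl
  rw [hcast, Finset.card_filter, Finset.sum_product]
  push_cast
  have : ∑ a ∈ Finset.range Y, ∑ b ∈ Finset.range Y,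
      (if ∀ p ∈ W, (p : ℤ) ∣ (a : ℤ) - b then (1 : ℝ) else 0) ≤ ∑ a ∈ Finset.range Y, ((Y : ℝ) / L + 1) := by
    refine Finset.sum_le_sum fun a ha => ?_
    have := hfib a ha
    rw [Finset.card_filter] at this
    push_cast at this
    exact this
  rw [Finset.sum_const, Finset.card_range, nsmul_eq_mul] at this
  calc _ ≤ (Y * ((Y : ℝ) / L + 1)) * L := by gcongr
    _ = _ := by field_simp

open ComplexConjugate in
theorem abs_sum_prod_residueSign_le (W : Finset ℕ) (hW : ∀ p ∈ W, p.Prime ∧ 2 < p) (Y : ℕ) :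
    |∑ a ∈ Finset.range Y, ∑ b ∈ Finset.range Y, ∏ p ∈ W, residueSign p ((a : ℤ) - b)|
      ≤ (∏ p ∈ W, 2 / √(p : ℝ)) * (Y ^ 2 + Y * ∏ p ∈ W, (p : ℝ)) := by
  choose! c e hc hexp hconj hsum using fun p (hp : p ∈ W) =>
    exists_fourier_residueSign p (hW p hp).1 (hW p hp).2
  set T := W.pi fun p => Finset.range p with hT
  let F : (∀ p ∈ W, ℕ) → ℂ := fun τ => ∑ a ∈ Finset.range Y, ∏ p ∈ W.attach, e p (τ p p.2) (a : ℤ)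
  have hsq : ∀ τ, F τ * conj (F τ) = ∑ a ∈ Finset.range Y, ∑ b ∈ Finset.range Y,
      ∏ p ∈ W.attach, e p (τ p p.2) ((a : ℤ) - b) := by
    intro τ
    simp only [F]
    rw [map_sum, Finset.sum_mul_sum]
    refine Finset.sum_congr rfl fun a _ => Finset.sum_congr rfl fun b _ => ?_
    rw [map_prod, ← Finset.prod_mul_distrib]
    refine Finset.prod_congr rfl fun p _ => ?_
    rw [hconj p p.2]
  have h1 : ((∑ a ∈ Finset.range Y, ∑ b ∈ Finset.range Y,
      ∏ p ∈ W, residueSign p ((a : ℤ) - b) : ℝ) : ℂ)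
      = ∑ τ ∈ T, (∏ p ∈ W.attach, c p (τ p p.2)) * (F τ * conj (F τ)) := by
    simp_rw [hsq, Finset.mul_sum]
    rw [Finset.sum_comm (s := T)]
    push_cast
    refine Finset.sum_congr rfl fun a _ => ?_
    rw [Finset.sum_comm (s := T)]
    refine Finset.sum_congr rfl fun b _ => ?_
    have hE : ∏ p ∈ W, (residueSign p ((a : ℤ) - b) : ℂ)
        = ∏ p ∈ W, ∑ t ∈ Finset.range p, c p t * e p t ((a : ℤ) - b) :=
      Finset.prod_congr rfl fun p hp => hexp p hp _
    rw [hE, Finset.prod_sum]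
    refine Finset.sum_congr rfl fun τ _ => ?_
    rw [Finset.prod_mul_distrib]
  have h2 : ∑ τ ∈ T, F τ * conj (F τ) = ((((Finset.range Y ×ˢ Finset.range Y).filter
      fun x => ∀ p ∈ W, (p : ℤ) ∣ (x.1 : ℤ) - x.2).card : ℝ) * ∏ p ∈ W, (p : ℝ) : ℝ) := by
    simp_rw [hsq]
    rw [Finset.sum_comm (s := T), Finset.card_filter, Finset.sum_product]
    push_cast
    rw [Finset.sum_mul]
    refine Finset.sum_congr rfl fun a _ => ?_
    rw [Finset.sum_comm (s := T), Finset.sum_mul]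
    refine Finset.sum_congr rfl fun b _ => ?_
    have hE : ∏ p ∈ W, ∑ t ∈ Finset.range p, e p t ((a : ℤ) - b)
        = ∏ p ∈ W, if (p : ℤ) ∣ (a : ℤ) - b then (p : ℂ) else 0 :=
      Finset.prod_congr rfl fun p hp => hsum p hp _
    rw [← Finset.prod_sum W (fun p => Finset.range p) (fun p t => e p t ((a : ℤ) - b)), hE]
    split_ifs with h
    · rw [Complex.ofReal_one, one_mul]
      exact Finset.prod_congr rfl fun p hp => if_pos (h p hp)
    · push Not at h
      obtain ⟨p, hp, hnd⟩ := h
      rw [Complex.ofReal_zero, zero_mul]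
      exact Finset.prod_eq_zero hp (if_neg hnd)
  have h3 : ∑ τ ∈ T, ‖F τ‖ ^ 2 = (((Finset.range Y ×ˢ Finset.range Y).filter
      fun x => ∀ p ∈ W, (p : ℤ) ∣ (x.1 : ℤ) - x.2).card : ℝ) * ∏ p ∈ W, (p : ℝ) := by
    have : ((∑ τ ∈ T, ‖F τ‖ ^ 2 : ℝ) : ℂ) = ∑ τ ∈ T, F τ * conj (F τ) := by
      push_cast
      refine Finset.sum_congr rfl fun τ _ => ?_
      rw [Complex.mul_conj, Complex.normSq_eq_norm_sq]
      push_cast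
      rfl
    rw [h2] at this
    exact_mod_cast this
  have h4 := card_pairs_mod_le W (fun p hp => (hW p hp).1) Y
  rw [← h3] at h4
  rw [← Real.norm_eq_abs, ← Complex.norm_real, h1]
  calc _ ≤ ∑ τ ∈ T, ‖(∏ p ∈ W.attach, c p (τ p p.2)) * (F τ * conj (F τ))‖ := norm_sum_le _ _
    _ ≤ ∑ τ ∈ T, (∏ p ∈ W, 2 / √(p : ℝ)) * ‖F τ‖ ^ 2 := by
        refine Finset.sum_le_sum fun τ _ => ?_
        rw [norm_mul, norm_mul, RCLike.norm_conj, ← sq, norm_prod]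
        gcongr
        rw [← Finset.prod_attach W]
        exact Finset.prod_le_prod (fun _ _ => norm_nonneg _) fun p _ => hc p p.2 _
    _ = (∏ p ∈ W, 2 / √(p : ℝ)) * ∑ τ ∈ T, ‖F τ‖ ^ 2 := by rw [Finset.mul_sum]
    _ ≤ _ := by gcongr

theorem Finset.sum_sum_sum_sum_comm {α β : Type*} (s : Finset α) (t : Finset β)
    (F : α → α → β → β → ℝ) :
    ∑ a ∈ s, ∑ b ∈ s, ∑ x ∈ t, ∑ y ∈ t, F a b x y = ∑ x ∈ t, ∑ y ∈ t, ∑ a ∈ s, ∑ b ∈ s, F a b x y := by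
  calc _ = ∑ u ∈ s ×ˢ s, ∑ v ∈ t ×ˢ t, F u.1 u.2 v.1 v.2 := by simp only [Finset.sum_product]
    _ = ∑ v ∈ t ×ˢ t, ∑ u ∈ s ×ˢ s, F u.1 u.2 v.1 v.2 := Finset.sum_comm
    _ = _ := by simp only [Finset.sum_product]

theorem Finset.prod_mul_prod_eq_prod_symmDiff {ι : Type*} [DecidableEq ι] (S T : Finset ι)
    (f : ι → ℝ) (hf : ∀ i, f i * f i = 1) :
    (∏ i ∈ S, f i) * ∏ i ∈ T, f i = (∏ i ∈ S \ T, f i) * ∏ i ∈ T \ S, f i := by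
  have h1 := Finset.prod_inter_mul_prod_sdiff S T f
  have h2 := Finset.prod_inter_mul_prod_sdiff T S f
  have h3 : (∏ i ∈ S ∩ T, f i) * ∏ i ∈ S ∩ T, f i = 1 := by
    rw [← Finset.prod_mul_distrib]
    exact Finset.prod_eq_one fun i _ => hf i
  rw [Finset.inter_comm] at h2
  rw [← h1, ← h2]
  linear_combination (∏ i ∈ S \ T, f i) * (∏ i ∈ T \ S, f i) * h3

theorem sum_pow_card_sdiff_le {ι : Type*} [DecidableEq ι] (s S : Finset ι) (R : ℕ) (hR : 0 < R)
    (hs : s.card ≤ 3 * R) (q : ℕ) (hS : S ∈ s.powersetCard q) :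
    ∑ T ∈ s.powersetCard q, (1 / (R : ℝ)) ^ (T \ S).card ≤ 21 * 2 ^ q := by
  obtain ⟨hSs, hSq⟩ := Finset.mem_powersetCard.mp hS
  have hR0 : (0 : ℝ) < R := by exact_mod_cast hR
  have hw : ∀ T : Finset ι, (1 / (R : ℝ)) ^ (T \ S).card = ∏ i ∈ T, if i ∈ S then 1 else 1 / (R : ℝ) := by
    intro T
    rw [Finset.prod_ite, Finset.prod_const_one, one_mul, Finset.prod_const, Finset.sdiff_eq_filter]
  calc ∑ T ∈ s.powersetCard q, (1 / (R : ℝ)) ^ (T \ S).card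
      ≤ ∑ T ∈ s.powerset, (1 / (R : ℝ)) ^ (T \ S).card := by
        refine Finset.sum_le_sum_of_subset_of_nonneg (fun T hT => Finset.mem_powerset.mpr
          (Finset.mem_powersetCard.mp hT).1) ?_
        intros; positivity
    _ = ∏ i ∈ s, (1 + if i ∈ S then 1 else 1 / (R : ℝ)) := by
        rw [Finset.prod_one_add]
        exact Finset.sum_congr rfl fun T _ => hw T
    _ = (∏ i ∈ S, 2) * ∏ i ∈ s \ S, (1 + 1 / (R : ℝ)) := by
        rw [← Finset.prod_sdiff hSs, mul_comm]
        congr 1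
        · exact Finset.prod_congr rfl fun i hi => by rw [if_pos hi]; norm_num
        · exact Finset.prod_congr rfl fun i hi => by rw [if_neg (Finset.mem_sdiff.mp hi).2]
    _ = 2 ^ q * (1 + 1 / (R : ℝ)) ^ (s \ S).card := by simp [hSq]
    _ ≤ 2 ^ q * 21 := by
        gcongr
        calc (1 + 1 / (R : ℝ)) ^ (s \ S).card ≤ (1 + 1 / (R : ℝ)) ^ (3 * R) := by
              gcongr
              · linarith [show (0 : ℝ) < 1 / R by positivity]
              · exact (Finset.card_le_card Finset.sdiff_subset).trans hs
          _ ≤ (Real.exp (1 / (R : ℝ))) ^ (3 * R) := by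
              gcongr
              linarith [Real.add_one_le_exp (1 / (R : ℝ))]
          _ = Real.exp 1 ^ 3 := by
              rw [← Real.exp_nat_mul, ← Real.exp_nat_mul]
              congr 1
              push_cast
              field_simp
          _ ≤ 2.7182818286 ^ 3 := by
              gcongr
              exact Real.exp_one_lt_d9.le
          _ ≤ 21 := by norm_num
    _ = _ := by ring

theorem card_filter_not_disjoint_le {ι : Type*} [DecidableEq ι] (s E : Finset ι) (hE : E ⊆ s)
    (q : ℕ) (hq : 1 ≤ q) (h : 4 * q * E.card ≤ s.card) :
    4 * ((s.powersetCard q).filter fun S => ¬ Disjoint S E).card ≤ s.card.choose q := by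
  rcases Finset.eq_empty_or_nonempty s with rfl | hs
  · rw [Finset.subset_empty.mp hE]
    simp
  obtain ⟨m, hm⟩ := Nat.exists_eq_succ_of_ne_zero hs.card_pos.ne'
  obtain ⟨r, rfl⟩ := Nat.exists_eq_add_of_le' hq
  have h1 : ((s.powersetCard (r + 1)).filter fun S => ¬ Disjoint S E).card ≤ E.card * m.choose r := by
    refine (Finset.card_le_card (t := E.biUnion fun p => (s.powersetCard (r + 1)).filter
      fun S => p ∈ S) ?_).trans (Finset.card_biUnion_le_card_mul _ _ _ ?_)
    · intro S hS
      obtain ⟨hS1, hS2⟩ := Finset.mem_filter.mp hS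
      obtain ⟨p, hp1, hp2⟩ := Finset.not_disjoint_iff.mp hS2
      exact Finset.mem_biUnion.mpr ⟨p, hp2, Finset.mem_filter.mpr ⟨hS1, hp1⟩⟩
    · intro p hp
      have hcard : ((s.erase p).powersetCard r).card = m.choose r := by
        rw [Finset.card_powersetCard, Finset.card_erase_of_mem (hE hp), hm]; rfl
      rw [← hcard]
      refine Finset.card_le_card_of_injOn (fun S => S.erase p) ?_ ?_
      · intro S hS
        obtain ⟨hS1, hS2⟩ := Finset.mem_filter.mp hS
        obtain ⟨hS3, hS4⟩ := Finset.mem_powersetCard.mp hS1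
        refine Finset.mem_powersetCard.mpr ⟨Finset.erase_subset_erase _ hS3, ?_⟩
        rw [Finset.card_erase_of_mem hS2, hS4]; rfl
      · intro S hS T hT hST
        have hS2 := (Finset.mem_filter.mp hS).2
        have hT2 := (Finset.mem_filter.mp hT).2
        rw [← Finset.insert_erase hS2, ← Finset.insert_erase hT2]
        exact congrArg _ hST
  have h2 := Nat.add_one_mul_choose_eq m r
  rw [hm] at h ⊢
  have h3 : (m + 1) * (4 * (E.card * m.choose r)) ≤ (m + 1) * (m + 1).choose (r + 1) := by
    calc (m + 1) * (4 * (E.card * m.choose r)) = 4 * E.card * ((m + 1) * m.choose r) := by ring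
      _ = (4 * (r + 1) * E.card) * (m + 1).choose (r + 1) := by rw [h2]; ring
      _ ≤ _ := Nat.mul_le_mul_right _ h
  have h4 := Nat.le_of_mul_le_mul_left h3 (Nat.succ_pos m)
  exact (Nat.mul_le_mul_left 4 h1).trans h4

theorem choose_le_two_mul_abs_sum_prod_residueSign (s : Finset ℕ) (q : ℕ) (hq : 1 ≤ q) (x : ℤ)
    (h : 4 * q * Nat.card {p // p ∈ s ∧ IsResidue p x} ≤ s.card) :
    (s.card.choose q : ℝ) ≤ 2 * |∑ S ∈ s.powersetCard q, ∏ p ∈ S, residueSign p x| := by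
  classical
  set E := s.filter fun p => IsResidue p x with hE
  have hcard : Nat.card {p // p ∈ s ∧ IsResidue p x} = E.card :=
    Nat.subtype_card E fun p => by rw [hE, Finset.mem_filter]
  rw [hcard] at h
  have h1 := card_filter_not_disjoint_le s E (Finset.filter_subset _ _) q hq h
  have h2 : |(∑ S ∈ s.powersetCard q, ∏ p ∈ S, residueSign p x) - (-1) ^ q * s.card.choose q|
      ≤ 2 * ((s.powersetCard q).filter fun S => ¬ Disjoint S E).card := by
    have : ((-1 : ℝ)) ^ q * s.card.choose q = ∑ S ∈ s.powersetCard q, (-1 : ℝ) ^ q := by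
      rw [Finset.sum_const, Finset.card_powersetCard, nsmul_eq_mul, mul_comm]
    rw [this, ← Finset.sum_sub_distrib, Finset.card_filter]
    push_cast
    rw [Finset.mul_sum]
    refine (Finset.abs_sum_le_sum_abs _ _).trans (Finset.sum_le_sum fun S hS => ?_)
    obtain ⟨hSs, hSq⟩ := Finset.mem_powersetCard.mp hS
    by_cases hd : Disjoint S E
    · rw [if_neg (not_not.mpr hd)]
      have : ∏ p ∈ S, residueSign p x = (-1) ^ q := by
        rw [← hSq]
        refine Finset.prod_eq_pow_card fun p hp => ?_
        refine if_neg fun hr => ?_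
        exact Finset.disjoint_left.mp hd hp (Finset.mem_filter.mpr ⟨hSs hp, hr⟩)
      rw [this]; simp
    · rw [if_pos hd]
      refine (abs_sub _ _).trans ?_
      rw [Finset.abs_prod, abs_pow]
      simp only [abs_residueSign]
      norm_num
  have h3 : (4 : ℝ) * ((s.powersetCard q).filter fun S => ¬ Disjoint S E).card ≤ s.card.choose q := by
    exact_mod_cast h1
  have h4 : |(-1 : ℝ) ^ q * s.card.choose q| = s.card.choose q := by
    rw [abs_mul, abs_pow]; simp
  have h5 := abs_sub_abs_le_abs_sub ((-1 : ℝ) ^ q * s.card.choose q)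
    (∑ S ∈ s.powersetCard q, ∏ p ∈ S, residueSign p x)
  rw [abs_sub_comm] at h2
  linarith

theorem sum_sq_sum_prod_residueSign_le (s : Finset ℕ) (P R q Y : ℕ) (hR : 0 < R)
    (hs : ∀ p ∈ s, p.Prime ∧ 2 < p ∧ R ≤ p ∧ p ≤ P) (hM : s.card ≤ 3 * R) :
    ∑ a ∈ Finset.range Y, ∑ b ∈ Finset.range Y,
      (∑ S ∈ s.powersetCard q, ∏ p ∈ S, residueSign p ((a : ℤ) - b)) ^ 2
      ≤ s.card.choose q * (21 * 8 ^ q * Y ^ 2) + (s.card.choose q) ^ 2 * (Y * (4 * P) ^ q) := by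
  have hR0 : (0 : ℝ) < R := by exact_mod_cast hR
  have hterm : ∀ S ∈ s.powersetCard q, ∀ T ∈ s.powersetCard q,
      ∑ a ∈ Finset.range Y, ∑ b ∈ Finset.range Y, (∏ p ∈ S, residueSign p ((a : ℤ) - b)) *
        ∏ p ∈ T, residueSign p ((a : ℤ) - b)
        ≤ 4 ^ q * Y ^ 2 * (1 / (R : ℝ)) ^ (T \ S).card + Y * (4 * P) ^ q := by
    intro S hS T hT
    obtain ⟨hSs, hSq⟩ := Finset.mem_powersetCard.mp hS
    obtain ⟨hTs, hTq⟩ := Finset.mem_powersetCard.mp hT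
    have hdisj : Disjoint (S \ T) (T \ S) := disjoint_sdiff_sdiff
    have hWs : ∀ p ∈ S \ T ∪ T \ S, p ∈ s := by
      intro p hp
      rcases Finset.mem_union.mp hp with h | h
      · exact hSs (Finset.mem_sdiff.mp h).1
      · exact hTs (Finset.mem_sdiff.mp h).1
    have hcardW : (S \ T ∪ T \ S).card = 2 * (T \ S).card := by
      rw [Finset.card_union_of_disjoint hdisj]
      have := Finset.card_sdiff_add_card_inter S T
      have h2 := Finset.card_sdiff_add_card_inter T S
      rw [Finset.inter_comm] at h2
      omega
    have hj : (T \ S).card ≤ q := hTq ▸ Finset.card_le_card Finset.sdiff_subset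
    have h1 : ∀ x : ℤ, (∏ p ∈ S, residueSign p x) * ∏ p ∈ T, residueSign p x
        = ∏ p ∈ S \ T ∪ T \ S, residueSign p x := by
      intro x
      rw [Finset.prod_mul_prod_eq_prod_symmDiff S T _ fun p => residueSign_mul_self p x,
        Finset.prod_union hdisj]
    simp_rw [h1]
    refine (le_abs_self _).trans ((abs_sum_prod_residueSign_le _
      (fun p hp => ⟨(hs p (hWs p hp)).1, (hs p (hWs p hp)).2.1⟩) Y).trans ?_)
    rw [mul_add]
    have hA : ∏ p ∈ S \ T ∪ T \ S, 2 / √(p : ℝ) ≤ 4 ^ q * (1 / (R : ℝ)) ^ (T \ S).card := by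
      calc ∏ p ∈ S \ T ∪ T \ S, 2 / √(p : ℝ) ≤ ∏ p ∈ S \ T ∪ T \ S, 2 / √(R : ℝ) := by
            refine Finset.prod_le_prod (fun _ _ => by positivity) fun p hp => ?_
            have : (R : ℝ) ≤ p := by exact_mod_cast (hs p (hWs p hp)).2.2.1
            gcongr
        _ = 4 ^ (T \ S).card * (1 / (R : ℝ)) ^ (T \ S).card := by
            rw [Finset.prod_const, hcardW, pow_mul, div_pow, Real.sq_sqrt hR0.le, ← mul_pow]
            congr 1; ring
        _ ≤ _ := by gcongr; norm_num
    have hB : (∏ p ∈ S \ T ∪ T \ S, 2 / √(p : ℝ)) * ∏ p ∈ S \ T ∪ T \ S, (p : ℝ) ≤ (4 * P) ^ q := by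
      rw [← Finset.prod_mul_distrib]
      calc ∏ p ∈ S \ T ∪ T \ S, 2 / √(p : ℝ) * p ≤ ∏ p ∈ S \ T ∪ T \ S, 2 * √(P : ℝ) := by
            refine Finset.prod_le_prod (fun _ _ => by positivity) fun p hp => ?_
            have : (p : ℝ) ≤ P := by exact_mod_cast (hs p (hWs p hp)).2.2.2
            rw [div_mul_eq_mul_div, mul_div_assoc, Real.div_sqrt]
            gcongr
        _ = (4 * P : ℝ) ^ (T \ S).card := by
            rw [Finset.prod_const, hcardW, pow_mul, mul_pow, Real.sq_sqrt (by positivity)]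
            congr 1; ring
        _ ≤ _ := by
            rcases Nat.eq_zero_or_pos (T \ S).card with h0 | h0
            · rw [h0, pow_zero]
              rcases Nat.eq_zero_or_pos q with hq | hq
              · rw [hq, pow_zero]
              · obtain ⟨p, hp⟩ := Finset.card_pos.mp (hSq ▸ hq)
                have h2 := (hs p (hSs hp)).2.1
                have h3 := (hs p (hSs hp)).2.2.2
                have : (1 : ℝ) ≤ P := by exact_mod_cast (by omega : 1 ≤ P)
                exact one_le_pow₀ (by linarith)
            · obtain ⟨p, hp⟩ := Finset.card_pos.mp h0
              have hp' := hTs (Finset.mem_sdiff.mp hp).1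
              have h2 := (hs p hp').2.1
              have h3 := (hs p hp').2.2.2
              have : (1 : ℝ) ≤ P := by exact_mod_cast (by omega : 1 ≤ P)
              exact pow_le_pow_right₀ (by linarith) hj
    have hC := mul_le_mul_of_nonneg_left hB (Nat.cast_nonneg (α := ℝ) Y)
    have hD := mul_le_mul_of_nonneg_right hA (sq_nonneg (Y : ℝ))
    nlinarith [hC, hD]
  calc ∑ a ∈ Finset.range Y, ∑ b ∈ Finset.range Y,
      (∑ S ∈ s.powersetCard q, ∏ p ∈ S, residueSign p ((a : ℤ) - b)) ^ 2
      = ∑ S ∈ s.powersetCard q, ∑ T ∈ s.powersetCard q,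
        ∑ a ∈ Finset.range Y, ∑ b ∈ Finset.range Y, (∏ p ∈ S, residueSign p ((a : ℤ) - b)) *
        ∏ p ∈ T, residueSign p ((a : ℤ) - b) := by
        simp_rw [sq, Finset.sum_mul_sum]
        exact Finset.sum_sum_sum_sum_comm _ _ _
    _ ≤ ∑ S ∈ s.powersetCard q, ∑ T ∈ s.powersetCard q,
        (4 ^ q * Y ^ 2 * (1 / (R : ℝ)) ^ (T \ S).card + Y * (4 * P) ^ q) :=
        Finset.sum_le_sum fun S hS => Finset.sum_le_sum fun T hT => hterm S hS T hT
    _ ≤ ∑ S ∈ s.powersetCard q, ((4 : ℝ) ^ q * (Y : ℝ) ^ 2 * (21 * 2 ^ q) + s.card.choose q * (Y * (4 * P) ^ q)) := by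
        refine Finset.sum_le_sum fun S hS => ?_
        rw [Finset.sum_add_distrib, ← Finset.mul_sum, Finset.sum_const, Finset.card_powersetCard,
          nsmul_eq_mul]
        gcongr
        exact sum_pow_card_sdiff_le s S R hR hM q hS
    _ = _ := by
        rw [Finset.sum_const, Finset.card_powersetCard, nsmul_eq_mul]
        have h8 : (8 : ℝ) ^ q = 4 ^ q * 2 ^ q := by rw [← mul_pow]; norm_num
        rw [h8]
        ring

theorem card_le_of_few_residues (s : Finset ℕ) (P R q N : ℕ) (hR : 0 < R)
    (hs : ∀ p ∈ s, p.Prime ∧ 2 < p ∧ R ≤ p ∧ p ≤ P) (hM : s.card ≤ 3 * R) (hq : 1 ≤ q)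
    (hqM : q ≤ s.card) (hN : 0 < N) (B : Finset ℕ)
    (hB : ∀ d ∈ B, d ≤ N ∧ 4 * q * Nat.card {p // p ∈ s ∧ IsResidue p (-d)} ≤ s.card) :
    (B.card : ℝ) ≤ 336 * 8 ^ q * N / s.card.choose q + 8 * (4 * P) ^ q := by
  have hC : (0 : ℝ) < s.card.choose q := by exact_mod_cast Nat.choose_pos hqM
  have hN0 : (0 : ℝ) < N := by exact_mod_cast hN
  have h1 := sum_sq_sum_prod_residueSign_le s P R q (2 * N) hR hs hM
  set f : ℤ → ℝ := fun x => ∑ S ∈ s.powersetCard q, ∏ p ∈ S, residueSign p x with hf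
  have h2 : (N : ℝ) * (B.card * ((s.card.choose q : ℝ) / 2) ^ 2) ≤
      ∑ a ∈ Finset.range (2 * N), ∑ b ∈ Finset.range (2 * N), f ((a : ℤ) - b) ^ 2 := by
    calc (N : ℝ) * (B.card * ((s.card.choose q : ℝ) / 2) ^ 2)
        = ∑ a ∈ Finset.range N, ∑ d ∈ B, ((s.card.choose q : ℝ) / 2) ^ 2 := by simp
      _ ≤ ∑ a ∈ Finset.range N, ∑ b ∈ Finset.range (2 * N), f ((a : ℤ) - b) ^ 2 := by
          refine Finset.sum_le_sum fun a ha => ?_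
          calc ∑ d ∈ B, ((s.card.choose q : ℝ) / 2) ^ 2 ≤ ∑ d ∈ B, f ((a : ℤ) - (a + d : ℕ)) ^ 2 := by
                refine Finset.sum_le_sum fun d hd => ?_
                have h3 := choose_le_two_mul_abs_sum_prod_residueSign s q hq (-d) (hB d hd).2
                rw [← sq_abs (f _)]
                have h4 : (a : ℤ) - (a + d : ℕ) = -d := by push_cast; ring
                rw [h4]
                gcongr
                simp only [hf]
                linarith
            _ = ∑ b ∈ B.map (addLeftEmbedding a), f ((a : ℤ) - b) ^ 2 := by
                rw [Finset.sum_map]; rfl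
            _ ≤ _ := by
                refine Finset.sum_le_sum_of_subset_of_nonneg ?_ fun _ _ _ => sq_nonneg _
                intro b hb
                obtain ⟨d, hd, rfl⟩ := Finset.mem_map.mp hb
                have := (hB d hd).1
                have := Finset.mem_range.mp ha
                simp only [addLeftEmbedding_apply, Finset.mem_range]
                omega
      _ ≤ _ := by
          refine Finset.sum_le_sum_of_subset_of_nonneg (Finset.range_mono (by omega)) ?_
          intros; positivity
  have h3 := h2.trans h1
  push_cast at h3
  rw [← sub_nonneg] at h3 ⊢
  have h4 : 336 * 8 ^ q * (N : ℝ) / s.card.choose q + 8 * (4 * P) ^ q - B.card =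
      (4 / (N * (s.card.choose q : ℝ) ^ 2)) * (s.card.choose q * (21 * 8 ^ q * (2 * N) ^ 2) +
        (s.card.choose q) ^ 2 * (2 * N * (4 * P) ^ q) -
        N * (B.card * ((s.card.choose q : ℝ) / 2) ^ 2)) := by
    field_simp
    ring
  rw [h4]
  exact mul_nonneg (by positivity) h3

theorem isIntegral_sqrt_mul_I (d : ℕ) : IsIntegral ℤ ((Real.sqrt d : ℂ) * Complex.I) := by
  refine ⟨Polynomial.X ^ 2 + Polynomial.C (d : ℤ), by monicity!, ?_⟩
  have : ((Real.sqrt d : ℂ)) ^ 2 = d := by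
    rw [← Complex.ofReal_pow, Real.sq_sqrt (by positivity)]; simp
  simp [mul_pow, this]

instance numberField_Kneg (d : ℕ) : NumberField (Kneg d) where
  to_charZero := inferInstance
  to_finiteDimensional := by
    unfold Kneg
    exact IntermediateField.adjoin.finiteDimensional (isIntegral_sqrt_mul_I d).tower_top

theorem dvd_of_isIntegral_mul_sq {d : ℕ} (hd : Squarefree d) (hd0 : 0 < d) (t : ℚ)
    (ht : IsIntegral ℤ ((d : ℚ) * t ^ 2)) : ∃ v : ℤ, (v : ℚ) = t := by
  have hdQ : (d : ℚ) ≠ 0 := by exact_mod_cast hd0.ne'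
  obtain ⟨m, hm⟩ := IsIntegrallyClosed.isIntegral_iff.mp ht
  have hw : IsIntegral ℤ ((d : ℚ) * t) := by
    refine IsIntegral.of_pow (n := 2) (by norm_num) ?_
    have : ((d : ℚ) * t) ^ 2 = (d : ℤ) * ((d : ℚ) * t ^ 2) := by push_cast; ring
    rw [this]
    exact isIntegral_algebraMap.mul ht
  obtain ⟨w, hw⟩ := IsIntegrallyClosed.isIntegral_iff.mp hw
  simp only [algebraMap_int_eq, eq_intCast] at hm hw
  have h1 : w ^ 2 = d * m := by
    have : (w : ℚ) ^ 2 = d * m := by rw [hw, hm]; ring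
    exact_mod_cast this
  have h2 : (d : ℤ) ∣ w :=
    ((Int.squarefree_natCast.mpr hd).dvd_pow_iff_dvd two_ne_zero).mp ⟨m, h1⟩
  obtain ⟨v, rfl⟩ := h2
  refine ⟨v, ?_⟩
  push_cast at hw
  exact mul_left_cancel₀ hdQ hw

open NumberField in
theorem exists_sqrt_neg_and_conj (d : ℕ) (hd : Squarefree d) (hd0 : 0 < d) :
    ∃ (s : 𝓞 (Kneg d)) (σ : 𝓞 (Kneg d) ≃+* 𝓞 (Kneg d)), s * s = -(d : 𝓞 (Kneg d)) ∧ σ s = -s ∧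
      (∀ x : 𝓞 (Kneg d), ∃ u v : ℤ, 2 * x = u + v * s) ∧
      Module.finrank ℤ (𝓞 (Kneg d)) = 2 := by
  have hdQ : (0 : ℚ) < d := by exact_mod_cast hd0
  set θ : ℂ := (Real.sqrt d : ℂ) * Complex.I with hθ
  have hθ2 : θ * θ = -(d : ℂ) := by
    have : ((Real.sqrt d : ℂ)) ^ 2 = d := by
      rw [← Complex.ofReal_pow, Real.sq_sqrt (by positivity)]; simp
    rw [hθ, mul_mul_mul_comm, Complex.I_mul_I, ← sq, this]; ring
  have hint : IsIntegral ℚ θ := (isIntegral_sqrt_mul_I d).tower_top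
  have hpoly : Polynomial.X ^ 2 + Polynomial.C (d : ℚ) = minpoly ℚ θ := by
    refine minpoly.eq_of_irreducible_of_monic ?_ ?_ (by monicity!)
    · refine Polynomial.irreducible_of_degree_le_three_of_not_isRoot ?_ ?_
      · have : (Polynomial.X ^ 2 + Polynomial.C (d : ℚ)).natDegree = 2 := by compute_degree!
        rw [this]; decide
      · intro x hx
        simp only [Polynomial.IsRoot, Polynomial.eval_add, Polynomial.eval_pow, Polynomial.eval_X,
          Polynomial.eval_C] at hx
        nlinarith [sq_nonneg x]
    · simp only [map_add, map_pow, Polynomial.aeval_X, Polynomial.aeval_C]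
      rw [sq, hθ2]; simp
  have hdeg : (minpoly ℚ θ).natDegree = 2 := by rw [← hpoly]; compute_degree!
  let γ : Kneg d := IntermediateField.AdjoinSimple.gen ℚ θ
  have hγ : ((γ : Kneg d) : ℂ) = θ := rfl
  have hγ2 : γ * γ = -(d : Kneg d) := by
    apply Subtype.ext
    push_cast
    exact hθ2
  have hfin : Module.finrank ℚ (Kneg d) = 2 := (IntermediateField.adjoin.finrank hint).trans hdeg
  have hspan : ∀ x : Kneg d, ∃ a b : ℚ, x = a + b * γ := by
    intro x
    obtain ⟨f, hf, hx⟩ := (IntermediateField.adjoin.powerBasis hint).exists_eq_aeval x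
    have hdim : (IntermediateField.adjoin.powerBasis hint).dim = 2 := hdeg
    rw [hdim] at hf
    obtain ⟨a, b, rfl⟩ := Polynomial.exists_eq_X_add_C_of_natDegree_le_one (by omega : f.natDegree ≤ 1)
    refine ⟨b, a, ?_⟩
    rw [IntermediateField.adjoin.powerBasis_gen] at hx
    rw [hx]
    simp only [map_add, map_mul, Polynomial.aeval_C, Polynomial.aeval_X, eq_ratCast]
    exact add_comm _ _
  obtain ⟨τ, hτ⟩ : ∃ τ : Kneg d →ₐ[ℚ] Kneg d, τ γ = -γ := by
    have hroot : -γ ∈ (minpoly ℚ θ).aroots (Kneg d) := by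
      rw [Polynomial.mem_aroots]
      refine ⟨minpoly.ne_zero hint, ?_⟩
      rw [← hpoly]
      simp only [map_add, map_pow, Polynomial.aeval_X, Polynomial.aeval_C]
      rw [neg_sq, sq, hγ2]
      simp
    exact ⟨(IntermediateField.algHomAdjoinIntegralEquiv ℚ hint).symm ⟨-γ, hroot⟩,
      IntermediateField.algHomAdjoinIntegralEquiv_symm_apply_gen ℚ hint ⟨-γ, hroot⟩⟩
  let e : Kneg d ≃ₐ[ℚ] Kneg d := AlgEquiv.ofBijective τ τ.bijective
  have heγ : e γ = -γ := hτ
  have hγint : IsIntegral ℤ γ := by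
    rw [← isIntegral_algebraMap_iff (B := ℂ) (algebraMap (Kneg d) ℂ).injective]
    exact isIntegral_sqrt_mul_I d
  obtain ⟨s, hs⟩ : ∃ s : 𝓞 (Kneg d), algebraMap (𝓞 (Kneg d)) (Kneg d) s = γ := ⟨⟨γ, hγint⟩, rfl⟩
  refine ⟨s, RingOfIntegers.mapRingEquiv e.toRingEquiv, ?_, ?_, ?_, ?_⟩
  · refine RingOfIntegers.coe_injective ?_
    rw [map_mul, hs, hγ2, map_neg, map_natCast]
  · refine RingOfIntegers.coe_injective ?_
    rw [map_neg, hs]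
    exact (congrArg e hs).trans heγ
  · intro x
    obtain ⟨a, b, hab⟩ := hspan (algebraMap (𝓞 (Kneg d)) (Kneg d) x)
    have hx : IsIntegral ℤ (algebraMap (𝓞 (Kneg d)) (Kneg d) x) := RingOfIntegers.isIntegral_coe x
    have hex : IsIntegral ℤ (e (algebraMap (𝓞 (Kneg d)) (Kneg d) x)) := hx.map (e.toRingEquiv.toRingHom.toIntAlgHom)
    have hexab : e (algebraMap (𝓞 (Kneg d)) (Kneg d) x) = a - b * γ := by
      rw [hab, map_add, map_mul, heγ]; simp; ring
    have h1 : IsIntegral ℤ (2 * a) := by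
      rw [← isIntegral_algebraMap_iff (B := Kneg d) (algebraMap ℚ (Kneg d)).injective]
      have := hx.add hex
      rw [hexab, hab] at this
      have hE : algebraMap ℚ (Kneg d) (2 * a) = a + b * γ + (a - b * γ) := by
        rw [eq_ratCast]; push_cast; ring
      rwa [hE]
    have h2 : IsIntegral ℤ ((d : ℚ) * (2 * b) ^ 2) := by
      rw [← isIntegral_algebraMap_iff (B := Kneg d) (algebraMap ℚ (Kneg d)).injective]
      have := ((hx.sub hex).pow 2).neg
      rw [hexab, hab] at this
      have hE : algebraMap ℚ (Kneg d) ((d : ℚ) * (2 * b) ^ 2) =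
          -(a + b * γ - (a - b * γ)) ^ 2 := by
        rw [eq_ratCast]; push_cast
        linear_combination (4 * (b : Kneg d) ^ 2) * hγ2
      rwa [hE]
    obtain ⟨u, hu⟩ := IsIntegrallyClosed.isIntegral_iff.mp h1
    obtain ⟨v, hv⟩ := dvd_of_isIntegral_mul_sq hd hd0 _ h2
    refine ⟨u, v, RingOfIntegers.coe_injective ?_⟩
    have hu' : ((u : ℚ) : Kneg d) = 2 * a := by
      rw [show (u : ℚ) = 2 * a from hu]; push_cast; ring
    have hv' : ((v : ℚ) : Kneg d) = 2 * b := by rw [hv]; push_cast; ring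
    push_cast at hu' hv'
    simp only [map_mul, map_add, map_ofNat, map_intCast]
    rw [hu', hv', hs, hab]; ring
  · rw [RingOfIntegers.rank, hfin]

/-- `O` is an order of rank two over `ℤ` in which `s` is a square root of `-d`, with the
automorphism `σ` taking `s` to `-s`, and which has index at most two over `ℤ[s]`. -/
structure IsImaginaryQuadratic {O : Type*} [CommRing O] (d : ℕ) (s : O) (σ : O ≃+* O) : Prop where
  pos : 0 < d
  mul_self : s * s = -(d : O)
  map_eq : σ s = -s
  exists_two_mul : ∀ x : O, ∃ u v : ℤ, 2 * x = u + v * s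
  finrank_eq : Module.finrank ℤ O = 2

/-- `a` and `b` are the two conjugate ideals of norm `p`, where `p` splits in `O`. -/
structure IsSplitPair {O : Type*} [CommRing O] [IsDedekindDomain O] [Module.Free ℤ O]
    (p : ℕ) (a b : Ideal O) : Prop where
  mul_eq : a * b = Ideal.span {(p : O)}
  sup_eq : a ⊔ b = ⊤
  absNorm_left : Ideal.absNorm a = p
  absNorm_right : Ideal.absNorm b = p

namespace IsSplitPair

variable {O : Type*} [CommRing O] [IsDedekindDomain O] [Module.Free ℤ O] {p : ℕ} {a b : Ideal O}

theorem symm (h : IsSplitPair p a b) : IsSplitPair p b a :=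
  ⟨by rw [mul_comm, h.mul_eq], by rw [sup_comm, h.sup_eq], h.absNorm_right, h.absNorm_left⟩

theorem natCast_mem (h : IsSplitPair p a b) : (p : O) ∈ a := by
  have : (p : O) ∈ a * b := by
    rw [h.mul_eq]; exact Ideal.mem_span_singleton_self _
  have hle : a * b ≤ a := Ideal.mul_le_left
  exact hle this

theorem ne_bot (h : IsSplitPair p a b) (hp : p.Prime) : a ≠ ⊥ := by
  rintro rfl
  have := h.absNorm_left
  rw [Ideal.absNorm_bot] at this
  exact hp.ne_zero this.symm

theorem isPrime (h : IsSplitPair p a b) (hp : p.Prime) : a.IsPrime :=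
  Ideal.isPrime_of_irreducible_absNorm (by rw [h.absNorm_left]; exact hp)

end IsSplitPair

theorem Ideal.eq_top_of_natCast_mem {O : Type*} [CommRing O] (I : Ideal O) (m n : ℕ)
    (h : m.Coprime n) (hm : (m : O) ∈ I) (hn : (n : O) ∈ I) : I = ⊤ := by
  rw [Ideal.eq_top_iff_one]
  have h1 := Nat.gcd_eq_gcd_ab m n
  rw [Nat.Coprime.gcd_eq_one h] at h1
  have h2 : (1 : O) = m * (Nat.gcdA m n : ℤ) + n * (Nat.gcdB m n : ℤ) := by
    simpa using congrArg (Int.cast (R := O)) h1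
  rw [h2]
  exact I.add_mem (I.mul_mem_right _ hm) (I.mul_mem_right _ hn)

theorem Ideal.mem_of_two_mul_mem {O : Type*} [CommRing O] (I : Ideal O) (p : ℕ) (hp : Odd p)
    (hpI : (p : O) ∈ I) (x : O) (hx : 2 * x ∈ I) : x ∈ I := by
  obtain ⟨k, rfl⟩ := hp
  have : x = ((2 * k + 1 : ℕ) : O) * x - k * (2 * x) := by push_cast; ring
  rw [this]
  exact I.sub_mem (I.mul_mem_right _ hpI) (I.mul_mem_left _ hx)

namespace IsImaginaryQuadratic

variable {O : Type*} [CommRing O] {d : ℕ} {s : O} {σ : O ≃+* O}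

theorem eq_zero_of_add_mul_eq_zero [CharZero O] (h : IsImaginaryQuadratic d s σ) (u v : ℤ)
    (huv : (u : O) + v * s = 0) : u = 0 ∧ v = 0 := by
  have h1 : ((u ^ 2 + d * v ^ 2 : ℤ) : O) = 0 := by
    push_cast
    linear_combination (u - v * s : O) * huv + (v : O) ^ 2 * h.mul_self
  have h2 : u ^ 2 + d * v ^ 2 = 0 := by exact_mod_cast h1
  have hd : (0 : ℤ) < d := by exact_mod_cast h.pos
  have hv : v = 0 := by
    by_contra hv
    have : 0 < v ^ 2 := by positivity
    nlinarith [sq_nonneg u, mul_pos hd this]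
  subst hv
  exact ⟨by nlinarith, rfl⟩

variable [IsDedekindDomain O] [Module.Free ℤ O] [Module.Finite ℤ O]

theorem absNorm_span_intCast (h : IsImaginaryQuadratic d s σ) (n : ℤ) :
    Ideal.absNorm (Ideal.span {(n : O)}) = n.natAbs ^ 2 := by
  rw [Ideal.absNorm_span_singleton]
  have := Algebra.norm_algebraMap (S := O) n
  rw [h.finrank_eq] at this
  simp only [algebraMap_int_eq, eq_intCast] at this
  rw [this, Int.natAbs_pow]

theorem four_mul_absNorm (h : IsImaginaryQuadratic d s σ) (x : O) (u v : ℤ)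
    (hx : 2 * x = u + v * s) :
    4 * (Ideal.absNorm (Ideal.span {x}) : ℤ) = u ^ 2 + d * v ^ 2 := by
  have h1 : Ideal.absNorm (Ideal.span {σ x}) = Ideal.absNorm (Ideal.span {x}) := by
    rw [Ideal.absNorm_span_singleton, Ideal.absNorm_span_singleton]
    congr 1
    exact Algebra.norm_eq_of_algEquiv (σ.toIntAlgEquiv) x
  have h2 : 2 * σ x = u - v * s := by
    have := congrArg σ hx
    simp only [map_mul, map_add, map_ofNat, map_intCast, h.map_eq] at this
    rw [this]; ring
  have h3 : ((4 : ℤ) : O) * (x * σ x) = ((u ^ 2 + d * v ^ 2 : ℤ) : O) := by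
    push_cast
    linear_combination (2 * σ x) * hx + (u + v * s : O) * h2 - (v : O) ^ 2 * h.mul_self
  have h4 : Ideal.absNorm (Ideal.span {((4 : ℤ) : O) * (x * σ x)}) =
      Ideal.absNorm (Ideal.span {((u ^ 2 + d * v ^ 2 : ℤ) : O)}) := by rw [h3]
  rw [h.absNorm_span_intCast, ← Ideal.span_singleton_mul_span_singleton,
    ← Ideal.span_singleton_mul_span_singleton, map_mul, map_mul, h.absNorm_span_intCast, h1] at h4
  have h5 : (4 * Ideal.absNorm (Ideal.span {x})) ^ 2 = (u ^ 2 + d * v ^ 2).natAbs ^ 2 := by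
    rw [← h4]
    norm_num
    ring
  have h6 := Nat.pow_left_injective (n := 2) (by norm_num) h5
  have h7 : (0 : ℤ) ≤ u ^ 2 + d * v ^ 2 := by positivity
  rw [← Int.natAbs_of_nonneg h7, ← h6]
  push_cast; rfl

theorem exists_represented (h : IsImaginaryQuadratic d s σ) (W : Finset ℕ)
    (hW : ∀ p ∈ W, p.Prime ∧ 2 < p) (hWne : W.Nonempty) (a b : ℕ → Ideal O)
    (hab : ∀ p ∈ W, IsSplitPair p (a p) (b p)) (g : ℕ) (hg : 0 < g)
    (x : O) (hx : (∏ p ∈ W, a p) ^ g = Ideal.span {x}) :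
    ∃ u v : ℕ, 0 < v ∧ v.Coprime ((∏ p ∈ W, p) ^ g) ∧
      u ^ 2 + d * v ^ 2 = 4 * (∏ p ∈ W, p) ^ g := by
  obtain ⟨u, v, huv⟩ := h.exists_two_mul x
  have hnorm := h.four_mul_absNorm x u v huv
  have hM : Ideal.absNorm (Ideal.span {x}) = (∏ p ∈ W, p) ^ g := by
    rw [← hx, map_pow, map_prod]
    congr 1
    exact Finset.prod_congr rfl fun p hp => (hab p hp).absNorm_left
  rw [hM] at hnorm
  have hcop : v.natAbs.Coprime ((∏ p ∈ W, p) ^ g) := by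
    refine Nat.Coprime.pow_right _ (Nat.Coprime.prod_right fun ℓ hℓ => ?_)
    obtain ⟨hℓp, hℓ2⟩ := hW ℓ hℓ
    rw [Nat.coprime_comm, hℓp.coprime_iff_not_dvd, ← Int.natCast_dvd]
    intro hv
    have hdvdM : (ℓ : ℤ) ∣ ((∏ p ∈ W, p) ^ g : ℕ) := by
      exact_mod_cast dvd_pow (Finset.dvd_prod_of_mem _ hℓ) hg.ne'
    have hu : (ℓ : ℤ) ∣ u := by
      have h1 : (ℓ : ℤ) ∣ u ^ 2 := by
        have h2 : u ^ 2 = 4 * ((∏ p ∈ W, p) ^ g : ℕ) - d * v ^ 2 := by linarith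
        rw [h2]
        exact dvd_sub (hdvdM.mul_left _) ((dvd_pow hv two_ne_zero).mul_left _)
      exact (Nat.prime_iff_prime_int.mp hℓp).dvd_of_dvd_pow h1
    have hsp := hab ℓ hℓ
    have hbprime := hsp.symm.isPrime hℓp
    have hℓb := hsp.symm.natCast_mem
    have hxb : x ∈ b ℓ := by
      refine Ideal.mem_of_two_mul_mem _ ℓ (hℓp.odd_of_ne_two (by omega)) hℓb x ?_
      obtain ⟨u', rfl⟩ := hu
      obtain ⟨v', rfl⟩ := hv
      rw [huv]
      have : (((ℓ : ℤ) * u' : ℤ) : O) + ((ℓ * v' : ℤ) : O) * s = ℓ * (u' + v' * s) := by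
        push_cast; ring
      rw [this]
      exact Ideal.mul_mem_right _ _ hℓb
    have hle : (∏ p ∈ W, a p) ^ g ≤ b ℓ := by
      rw [hx, Ideal.span_singleton_le_iff_mem]; exact hxb
    obtain ⟨p, hpW, hpb⟩ := (Ideal.IsPrime.prod_le hbprime).mp (hbprime.le_of_pow_le hle)
    by_cases hpℓ : p = ℓ
    · subst hpℓ
      have := hsp.sup_eq
      rw [sup_eq_right.mpr hpb] at this
      exact hbprime.ne_top this
    · refine hbprime.ne_top (Ideal.eq_top_of_natCast_mem _ p ℓ
        ((Nat.coprime_primes (hW p hpW).1 hℓp).mpr hpℓ) (hpb (hab p hpW).natCast_mem) hℓb)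
  refine ⟨u.natAbs, v.natAbs, Nat.pos_of_ne_zero fun h0 => ?_, hcop, ?_⟩
  · rw [h0, Nat.coprime_zero_left, Nat.pow_eq_one] at hcop
    rcases hcop with h1 | h1
    · obtain ⟨p, hp⟩ := hWne
      have := Finset.dvd_prod_of_mem (fun p => p) hp
      rw [h1, Nat.dvd_one] at this
      have := (hW p hp).2
      omega
    · omega
  · zify
    rw [sq_abs, sq_abs]
    push_cast at hnorm
    linarith

variable [CharZero O]

theorem exists_isSplitPair (h : IsImaginaryQuadratic d s σ) (p : ℕ) (hp : p.Prime) (hp2 : 2 < p)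
    (hpd : IsResidue p (-d)) : ∃ a b : Ideal O, IsSplitPair p a b := by
  obtain ⟨h0, y, hy⟩ := hpd
  have : NeZero p := ⟨hp.ne_zero⟩
  set c : ℕ := y.val with hc
  have hcy : (c : ZMod p) = y := ZMod.natCast_zmod_val y
  have hpc : ¬ p ∣ c := by
    intro hdvd
    rw [← ZMod.natCast_eq_zero_iff, hcy] at hdvd
    rw [hdvd, mul_zero] at hy
    exact h0 hy
  obtain ⟨m, hm⟩ : p ∣ c ^ 2 + d := by
    rw [← ZMod.natCast_eq_zero_iff]
    push_cast at hy ⊢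
    rw [hcy, sq, ← hy]; ring
  have hmO : (c : O) ^ 2 + d = p * m := by exact_mod_cast congrArg (Nat.cast (R := O)) hm
  have hodd : Odd p := hp.odd_of_ne_two (by omega)
  have hcop : Nat.Coprime p (2 * c) := by
    rw [hp.coprime_iff_not_dvd]
    intro hdvd
    rcases hp.dvd_mul.mp hdvd with h1 | h1
    · exact absurd (Nat.le_of_dvd (by norm_num) h1) (by omega)
    · exact hpc h1
  have hnd : ∀ e : ℤ, e = 1 ∨ e = -1 → ¬ (p : O) ∣ (c : O) + e * s := by
    rintro e he ⟨w, hw⟩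
    obtain ⟨u, v, huv⟩ := h.exists_two_mul w
    have h1 : ((2 * c - p * u : ℤ) : O) + ((2 * e - p * v : ℤ) : O) * s = 0 := by
      push_cast
      linear_combination 2 * hw + (p : O) * huv
    have h2 := (h.eq_zero_of_add_mul_eq_zero _ _ h1).2
    have h3 : (p : ℤ) ∣ 2 := by
      rcases he with rfl | rfl
      · exact ⟨v, by linarith⟩
      · exact ⟨-v, by linarith⟩
    have h4 : p ∣ 2 := by exact_mod_cast h3
    exact absurd (Nat.le_of_dvd (by norm_num) h4) (by omega)
  set a : Ideal O := Ideal.span {(p : O), (c : O) - s} with ha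
  set b : Ideal O := Ideal.span {(p : O), (c : O) + s} with hb
  have hpa : (p : O) ∈ a := Ideal.subset_span (by simp)
  have hpb : (p : O) ∈ b := Ideal.subset_span (by simp)
  have hca : (c : O) - s ∈ a := Ideal.subset_span (by simp)
  have hcb : (c : O) + s ∈ b := Ideal.subset_span (by simp)
  have hsup : a ⊔ b = ⊤ := by
    refine Ideal.eq_top_of_natCast_mem _ p (2 * c) hcop (Ideal.mem_sup_left hpa) ?_
    have : ((2 * c : ℕ) : O) = (c - s) + (c + s) := by push_cast; ring
    rw [this]
    exact Ideal.add_mem _ (Ideal.mem_sup_left hca) (Ideal.mem_sup_right hcb)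
  have hle : a * b ≤ Ideal.span {(p : O)} := by
    rw [ha, hb, Ideal.span_mul_span', Ideal.span_le]
    rintro x ⟨y, hy, z, hz, rfl⟩
    simp only [Set.mem_insert_iff, Set.mem_singleton_iff] at hy hz
    simp only [SetLike.mem_coe, Ideal.mem_span_singleton]
    rcases hy with rfl | rfl <;> rcases hz with rfl | rfl
    · exact Dvd.intro _ rfl
    · exact Dvd.intro _ rfl
    · exact Dvd.intro_left _ rfl
    · exact ⟨m, by linear_combination hmO - h.mul_self⟩
  have hmul : a * b = Ideal.span {(p : O)} := by
    refine le_antisymm hle ?_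
    rw [Ideal.span_singleton_le_iff_mem, Ideal.mul_eq_inf_of_coprime hsup]
    exact ⟨hpa, hpb⟩
  have hdvd : ∀ e : ℤ, (e = 1 ∨ e = -1) → Ideal.span {(p : O), (c : O) - e * s} ≠ ⊤ := by
    intro e he htop
    refine hnd e he ?_
    rw [Ideal.eq_top_iff_one, Ideal.mem_span_pair] at htop
    obtain ⟨x, y, hxy⟩ := htop
    have he2 : (e : O) * e = 1 := by rcases he with rfl | rfl <;> simp
    refine ⟨x * (c + e * s) + y * m, ?_⟩
    linear_combination (-(c + e * s) : O) * hxy + y * hmO - y * h.mul_self * (e * e : O)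
      + (y * d : O) * he2
  have hatop : a ≠ ⊤ := by
    have := hdvd 1 (Or.inl rfl)
    simpa [ha] using this
  have hbtop : b ≠ ⊤ := by
    have := hdvd (-1) (Or.inr rfl)
    simpa [hb] using this
  have hnorm : Ideal.absNorm a * Ideal.absNorm b = p ^ 2 := by
    rw [← map_mul, hmul]
    exact h.absNorm_span_intCast (p : ℤ) ▸ by simp
  obtain ⟨h1, h2⟩ := (hp.mul_eq_prime_sq_iff
    (fun h1 => hatop (Ideal.absNorm_eq_one_iff.mp h1))
    (fun h1 => hbtop (Ideal.absNorm_eq_one_iff.mp h1))).mp hnorm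
  exact ⟨a, b, hmul, hsup, h1, h2⟩

end IsImaginaryQuadratic

section IdealClass

variable {O : Type*} [CommRing O] [IsDedekindDomain O]

open Classical in
/-- The class of a nonzero ideal, with value `1` at the zero ideal. -/
noncomputable def idealClass (I : Ideal O) : ClassGroup O :=
  if h : I ∈ nonZeroDivisors (Ideal O) then ClassGroup.mk0 ⟨I, h⟩ else 1

theorem idealClass_of_ne_bot {I : Ideal O} (hI : I ≠ ⊥) :
    idealClass I = ClassGroup.mk0 ⟨I, mem_nonZeroDivisors_iff_ne_zero.mpr hI⟩ :=
  dif_pos _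

theorem idealClass_mul {I J : Ideal O} (hI : I ≠ ⊥) (hJ : J ≠ ⊥) :
    idealClass (I * J) = idealClass I * idealClass J := by
  rw [idealClass_of_ne_bot hI, idealClass_of_ne_bot hJ, idealClass_of_ne_bot (mul_ne_zero hI hJ),
    ← map_mul]
  rfl

theorem idealClass_top : idealClass (⊤ : Ideal O) = 1 := by
  rw [idealClass_of_ne_bot top_ne_bot, ClassGroup.mk0_eq_one_iff]
  exact ⟨1, by simp⟩

theorem idealClass_prod {ι : Type*} (W : Finset ι) (a : ι → Ideal O) (ha : ∀ i ∈ W, a i ≠ ⊥) :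
    idealClass (∏ i ∈ W, a i) = ∏ i ∈ W, idealClass (a i) := by
  classical
  induction W using Finset.induction_on with
  | empty => simpa using idealClass_top
  | insert i W hi ih =>
    rw [Finset.prod_insert hi, Finset.prod_insert hi, idealClass_mul (ha i (by simp)),
      ih fun j hj => ha j (by simp [hj])]
    exact Finset.prod_ne_zero_iff.mpr fun j hj => ha j (by simp [hj])

theorem idealClass_pow {I : Ideal O} (hI : I ≠ ⊥) (n : ℕ) :
    idealClass (I ^ n) = idealClass I ^ n := by
  simpa using idealClass_prod (Finset.range n) (fun _ => I) fun _ _ => hI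

theorem exists_eq_span_singleton_of_idealClass_eq_one {I : Ideal O} (h : idealClass I = 1) :
    ∃ x, I = Ideal.span {x} := by
  by_cases hI : I = ⊥
  · exact ⟨0, by simpa using hI⟩
  · rw [idealClass_of_ne_bot hI, ClassGroup.mk0_eq_one_iff] at h
    exact h.principal

theorem IsSplitPair.idealClass_mul_idealClass [Module.Free ℤ O] {p : ℕ} {a b : Ideal O}
    (h : IsSplitPair p a b) (hp : p.Prime) : idealClass a * idealClass b = 1 := by
  have ha := h.ne_bot hp
  have hb := h.symm.ne_bot hp
  rw [← idealClass_mul ha hb, idealClass_of_ne_bot (mul_ne_zero ha hb), ClassGroup.mk0_eq_one_iff]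
  exact ⟨p, h.mul_eq⟩

end IdealClass

theorem IsImaginaryQuadratic.exists_represented_of_prod_eq {O : Type*} [CommRing O]
    [IsDedekindDomain O] [Module.Free ℤ O] [Module.Finite ℤ O] {d : ℕ} {s : O} {σ : O ≃+* O}
    (h : IsImaginaryQuadratic d s σ) (g : ℕ) (hg : 0 < g) (a b : ℕ → Ideal O) (S T : Finset ℕ)
    (hp : ∀ p ∈ S ∪ T, p.Prime ∧ 2 < p) (hab : ∀ p ∈ S ∪ T, IsSplitPair p (a p) (b p))
    (hne : S ≠ T) (hST : (∏ p ∈ S, idealClass (a p)) ^ g = (∏ p ∈ T, idealClass (a p)) ^ g) :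
    ∃ u v : ℕ, 0 < v ∧ v.Coprime ((∏ p ∈ S \ T ∪ T \ S, p) ^ g) ∧
      u ^ 2 + d * v ^ 2 = 4 * (∏ p ∈ S \ T ∪ T \ S, p) ^ g := by
  classical
  set W := S \ T ∪ T \ S with hW
  have hWsub : W ⊆ S ∪ T := Finset.union_subset_union Finset.sdiff_subset Finset.sdiff_subset
  have hWne : W.Nonempty := by
    by_contra hempty
    rw [Finset.not_nonempty_iff_eq_empty, hW, Finset.union_eq_empty, Finset.sdiff_eq_empty_iff_subset,
      Finset.sdiff_eq_empty_iff_subset] at hempty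
    exact hne (hempty.1.antisymm hempty.2)
  let a' : ℕ → Ideal O := fun p => if p ∈ S then a p else b p
  let b' : ℕ → Ideal O := fun p => if p ∈ S then b p else a p
  have hab' : ∀ p ∈ W, IsSplitPair p (a' p) (b' p) := by
    intro p hpW
    have := hab p (hWsub hpW)
    by_cases hpS : p ∈ S
    · simpa [a', b', hpS] using this
    · simpa [a', b', hpS] using this.symm
  have hclass : idealClass ((∏ p ∈ W, a' p) ^ g) = 1 := by
    have ha'ne : ∀ p ∈ W, a' p ≠ ⊥ := fun p hpW => (hab' p hpW).ne_bot (hp p (hWsub hpW)).1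
    rw [idealClass_pow (Finset.prod_ne_zero_iff.mpr ha'ne), idealClass_prod _ _ ha'ne, hW,
      Finset.prod_union disjoint_sdiff_sdiff]
    have h1 : ∏ p ∈ S \ T, idealClass (a' p) = ∏ p ∈ S \ T, idealClass (a p) :=
      Finset.prod_congr rfl fun p hpS => by simp [a', (Finset.mem_sdiff.mp hpS).1]
    have h2 : ∏ p ∈ T \ S, idealClass (a' p) = (∏ p ∈ T \ S, idealClass (a p))⁻¹ := by
      rw [← Finset.prod_inv_distrib]
      refine Finset.prod_congr rfl fun p hpT => ?_
      have hpU : p ∈ S ∪ T := Finset.mem_union_right _ (Finset.mem_sdiff.mp hpT).1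
      have := (hab p hpU).idealClass_mul_idealClass (hp p hpU).1
      simp only [a', (Finset.mem_sdiff.mp hpT).2, if_false]
      exact eq_inv_of_mul_eq_one_right this
    have h3 := Finset.prod_inter_mul_prod_sdiff S T fun p => idealClass (a p)
    have h4 := Finset.prod_inter_mul_prod_sdiff T S fun p => idealClass (a p)
    rw [Finset.inter_comm] at h4
    rw [← h3, ← h4, mul_pow, mul_pow] at hST
    rw [h1, h2, mul_pow, inv_pow, mul_left_cancel hST, mul_inv_cancel]
  obtain ⟨x, hx⟩ := exists_eq_span_singleton_of_idealClass_eq_one hclass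
  exact h.exists_represented W (fun p hpW => hp p (hWsub hpW)) hWne a' b' hab' g hg x hx

section IdealDivisors

variable {O : Type*} [CommRing O] [IsDedekindDomain O]

theorem Ideal.finite_dvd (I : Ideal O) (hI : I ≠ ⊥) : Finite {J : Ideal O // J ∣ I} := by
  have := UniqueFactorizationMonoid.fintypeSubtypeDvd I hI
  exact Finite.of_fintype _

theorem Ideal.card_dvd_mul_le (I J : Ideal O) (hI : I ≠ ⊥) (hJ : J ≠ ⊥) :
    Nat.card {L : Ideal O // L ∣ I * J} ≤
      Nat.card {L : Ideal O // L ∣ I} * Nat.card {L : Ideal O // L ∣ J} := by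
  have := Ideal.finite_dvd I hI
  have := Ideal.finite_dvd J hJ
  rw [← Nat.card_prod]
  refine Nat.card_le_card_of_surjective
    (fun x : {L : Ideal O // L ∣ I} × {L : Ideal O // L ∣ J} =>
      (⟨x.1.1 * x.2.1, mul_dvd_mul x.1.2 x.2.2⟩ : {L : Ideal O // L ∣ I * J})) ?_
  rintro ⟨L, hL⟩
  obtain ⟨L₁, L₂, h1, h2, rfl⟩ := exists_dvd_and_dvd_of_dvd_mul hL
  exact ⟨(⟨L₁, h1⟩, ⟨L₂, h2⟩), rfl⟩

theorem Ideal.card_dvd_prime_pow_le (I : Ideal O) (hI : Prime I) (n : ℕ) :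
    Nat.card {L : Ideal O // L ∣ I ^ n} ≤ n + 1 := by
  have : Nat.card (Fin (n + 1)) = n + 1 := by simp
  rw [← this]
  refine Nat.card_le_card_of_surjective
    (fun i : Fin (n + 1) => (⟨I ^ (i : ℕ), pow_dvd_pow _ (by omega)⟩ : {L : Ideal O // L ∣ I ^ n})) ?_
  rintro ⟨L, hL⟩
  obtain ⟨i, hi, h⟩ := (dvd_prime_pow hI n).mp hL
  exact ⟨⟨i, by omega⟩, Subtype.ext (associated_iff_eq.mp h).symm⟩

variable [Module.Free ℤ O] [Module.Finite ℤ O]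

theorem Ideal.card_dvd_span_prime_pow_le (h : ∀ n : ℤ, Ideal.absNorm (Ideal.span {(n : O)}) = n.natAbs ^ 2)
    (p : ℕ) (hp : p.Prime) (n : ℕ) :
    Nat.card {L : Ideal O // L ∣ Ideal.span {(p : O)} ^ n} ≤ (n + 1) ^ 2 := by
  have hnorm : Ideal.absNorm (Ideal.span {(p : O)}) = p ^ 2 := by simpa using h p
  have htop : ¬ IsUnit (Ideal.span {(p : O)}) := by
    intro hu
    rw [Ideal.isUnit_iff.mp hu, Ideal.absNorm_top] at hnorm
    exact hp.one_lt.ne' (by nlinarith [hp.one_lt])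
  have hbot : Ideal.span {(p : O)} ≠ ⊥ := by
    intro hb
    rw [hb, Ideal.absNorm_bot] at hnorm
    exact (pow_ne_zero 2 hp.ne_zero) hnorm.symm
  obtain ⟨P, hP, Q, hPQ⟩ := WfDvdMonoid.exists_irreducible_factor htop hbot
  have hnotone : ∀ {J : Ideal O}, ¬ IsUnit J → Ideal.absNorm J ≠ 1 := fun hJ h1 =>
    hJ (Ideal.isUnit_iff.mpr (Ideal.absNorm_eq_one_iff.mp h1))
  by_cases hQ : IsUnit Q
  · have : Ideal.span {(p : O)} = P := by
      rw [hPQ, Ideal.isUnit_iff.mp hQ, Ideal.mul_top]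
    rw [this]
    exact (Ideal.card_dvd_prime_pow_le P hP.prime n).trans (by nlinarith)
  · have hmul : Ideal.absNorm P * Ideal.absNorm Q = p ^ 2 := by rw [← map_mul, ← hPQ, hnorm]
    have hQn := ((hp.mul_eq_prime_sq_iff (hnotone hP.not_isUnit) (hnotone hQ)).mp hmul).2
    have hQ0 : Q ≠ 0 := by rintro rfl; exact hbot (by rw [hPQ, mul_zero]; rfl)
    have hQp : Prime Q := Ideal.prime_of_isPrime hQ0
      (Ideal.isPrime_of_irreducible_absNorm (by rw [hQn]; exact hp))
    rw [hPQ, mul_pow, sq]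
    refine (Ideal.card_dvd_mul_le _ _ (pow_ne_zero _ hP.ne_zero) (pow_ne_zero _ hQ0)).trans ?_
    exact Nat.mul_le_mul (Ideal.card_dvd_prime_pow_le P hP.prime n)
      (Ideal.card_dvd_prime_pow_le Q hQp n)

theorem Ideal.card_dvd_span_natCast_le
    (h : ∀ n : ℤ, Ideal.absNorm (Ideal.span {(n : O)}) = n.natAbs ^ 2) (n : ℕ) (hn : n ≠ 0) :
    Nat.card {L : Ideal O // L ∣ Ideal.span {(n : O)}} ≤ n.divisors.card ^ 2 := by
  have hne : ∀ m : ℕ, m ≠ 0 → Ideal.span {(m : O)} ≠ ⊥ := by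
    intro m hm hb
    have := h m
    rw [Int.cast_natCast, hb, Ideal.absNorm_bot] at this
    simp at this
    exact hm (pow_eq_zero_iff two_ne_zero |>.mp this.symm)
  induction n using Nat.recOnPosPrimePosCoprime with
  | prime_pow p n hp hn0 =>
    rw [Nat.divisors_prime_pow hp, Finset.card_map, Finset.card_range]
    have := Ideal.card_dvd_span_prime_pow_le h p hp n
    rwa [Ideal.span_singleton_pow, ← Nat.cast_pow] at this
  | zero => exact absurd rfl hn
  | one =>
    have := Ideal.card_dvd_span_prime_pow_le h 2 Nat.prime_two 0
    simpa using this
  | coprime a b ha hb hab iha ihb =>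
    rw [hab.card_divisors_mul, mul_pow, Nat.cast_mul, ← Ideal.span_singleton_mul_span_singleton]
    exact (Ideal.card_dvd_mul_le _ _ (hne a (by omega)) (hne b (by omega))).trans
      (Nat.mul_le_mul (iha (by omega)) (ihb (by omega)))

end IdealDivisors

namespace IsImaginaryQuadratic

variable {O : Type*} [CommRing O] [IsDedekindDomain O] [Module.Free ℤ O] [Module.Finite ℤ O]
  [CharZero O] {d : ℕ} {s : O} {σ : O ≃+* O}

theorem exists_mem_absNorm_le (h : IsImaginaryQuadratic d s σ) (I : Ideal O) (hI : I ≠ ⊥) :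
    ∃ x ∈ I, x ≠ 0 ∧ Ideal.absNorm (Ideal.span {x}) ≤ 4 * d.sqrt * Ideal.absNorm I := by
  set N := Ideal.absNorm I with hN
  have hN0 : 0 < N := Nat.pos_of_ne_zero fun h0 => hI (Ideal.absNorm_eq_zero_iff.mp h0)
  have hcard : Nat.card (O ⧸ I) = N := by
    rw [hN, Ideal.absNorm_apply, Submodule.cardQuot_apply]
  have hfin : Finite (O ⧸ I) := Nat.finite_of_card_ne_zero (by rw [hcard]; exact hN0.ne')
  set r := d.sqrt with hr
  have hr0 : 0 < r := Nat.sqrt_pos.mpr h.pos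
  set A := (N * r).sqrt with hA
  set B := (N / r).sqrt with hB
  have hA1 : A * A ≤ N * r := Nat.sqrt_le _
  have hA2 : N * r < (A + 1) * (A + 1) := Nat.lt_succ_sqrt _
  have hB1 : B * B * r ≤ N := (Nat.mul_le_mul_right r (Nat.sqrt_le _)).trans (Nat.div_mul_le_self N r)
  have hB2 : N < (B + 1) * (B + 1) * r := by
    rw [← Nat.div_lt_iff_lt_mul hr0]
    exact Nat.lt_succ_sqrt _
  have hd : d ≤ 3 * (r * r) := by
    have h1 := Nat.sqrt_le_add d
    nlinarith
  have hlt : N < (A + 1) * (B + 1) := by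
    by_contra! hle
    have h1 : (A + 1) * (B + 1) * ((A + 1) * (B + 1)) ≤ N * N := Nat.mul_le_mul hle hle
    have h2 : N * r * N < (A + 1) * (A + 1) * ((B + 1) * (B + 1) * r) := Nat.mul_lt_mul'' hA2 hB2
    have h3 := Nat.mul_le_mul_right r h1
    nlinarith
  let f : Fin (A + 1) × Fin (B + 1) → O ⧸ I := fun i =>
    Ideal.Quotient.mk I (((i.1 : ℕ) : O) + ((i.2 : ℕ) : O) * s)
  have hninj : ¬ Function.Injective f := by
    intro hinj
    have := Nat.card_le_card_of_injective f hinj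
    rw [hcard, Nat.card_prod, Nat.card_fin, Nat.card_fin] at this
    omega
  simp only [Function.Injective, not_forall] at hninj
  obtain ⟨i, j, hij, hne⟩ := hninj
  set u : ℤ := (i.1 : ℕ) - (j.1 : ℕ) with hu
  set v : ℤ := (i.2 : ℕ) - (j.2 : ℕ) with hv
  have hmem : (u : O) + v * s ∈ I := by
    have h1 := Ideal.Quotient.eq.mp hij
    rw [hu, hv]
    push_cast
    convert h1 using 1
    ring
  refine ⟨u + v * s, hmem, ?_, ?_⟩
  · intro h0
    obtain ⟨h1, h2⟩ := h.eq_zero_of_add_mul_eq_zero u v h0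
    exact hne (Prod.ext (Fin.ext (by omega)) (Fin.ext (by omega)))
  · have h1 := h.four_mul_absNorm (u + v * s) (2 * u) (2 * v) (by push_cast; ring)
    have hu2 : u ^ 2 ≤ A * A := by
      rw [← sq_abs]
      have : |u| ≤ A := by rw [abs_le]; omega
      nlinarith [abs_nonneg u]
    have hv2 : v ^ 2 ≤ B * B := by
      rw [← sq_abs]
      have : |v| ≤ B := by rw [abs_le]; omega
      nlinarith [abs_nonneg v]
    zify at hA1 hB1 hd ⊢
    have h2 : (d : ℤ) * v ^ 2 ≤ 3 * (r * r) * (B * B) := by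
      calc (d : ℤ) * v ^ 2 ≤ d * (B * B) := by gcongr
        _ ≤ _ := by gcongr
    have h3 : (B * B * r : ℤ) * (3 * r) ≤ N * (3 * r) := by gcongr
    nlinarith

theorem card_classGroup_le (h : IsImaginaryQuadratic d s σ) :
    Nat.card (ClassGroup O) ≤ ∑ n ∈ Finset.Icc 1 (4 * d.sqrt), n.divisors.card ^ 2 := by
  have hex : ∀ c : ClassGroup O, ∃ J : Ideal O, J ≠ ⊥ ∧ idealClass J = c ∧
      Ideal.absNorm J ≤ 4 * d.sqrt := by
    intro c
    obtain ⟨⟨I, hI⟩, hIc⟩ := ClassGroup.mk0_surjective c⁻¹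
    have hI0 : I ≠ ⊥ := nonZeroDivisors.ne_zero hI
    obtain ⟨x, hxI, hx0, hxN⟩ := h.exists_mem_absNorm_le I hI0
    obtain ⟨J, hJ⟩ := Ideal.dvd_span_singleton.mpr hxI
    have hxbot : Ideal.span {x} ≠ ⊥ := by rwa [Ne, Ideal.span_singleton_eq_bot]
    have hJ0 : J ≠ ⊥ := by
      rintro rfl
      exact hxbot (by rw [hJ]; exact mul_zero I)
    refine ⟨J, hJ0, ?_, ?_⟩
    · have h1 : idealClass (Ideal.span {x}) = 1 := by
        rw [idealClass_of_ne_bot hxbot, ClassGroup.mk0_eq_one_iff]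
        exact ⟨x, rfl⟩
      rw [hJ, idealClass_mul hI0 hJ0, idealClass_of_ne_bot hI0, hIc] at h1
      exact (inv_mul_eq_one.mp h1).symm
    · rw [hJ, map_mul, mul_comm (Ideal.absNorm I)] at hxN
      exact Nat.le_of_mul_le_mul_right hxN
        (Nat.pos_of_ne_zero fun h0 => hI0 (Ideal.absNorm_eq_zero_iff.mp h0))
  choose J hJ0 hJc hJN using hex
  have hpos : ∀ c, 0 < Ideal.absNorm (J c) := fun c =>
    Nat.pos_of_ne_zero fun h0 => hJ0 c (Ideal.absNorm_eq_zero_iff.mp h0)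
  have hne : ∀ n : Finset.Icc 1 (4 * d.sqrt), Ideal.span {((n : ℕ) : O)} ≠ ⊥ := by
    intro n
    have := (Finset.mem_Icc.mp n.2).1
    rw [Ne, Ideal.span_singleton_eq_bot, Nat.cast_eq_zero]
    omega
  have : ∀ n : Finset.Icc 1 (4 * d.sqrt), Finite {L : Ideal O // L ∣ Ideal.span {((n : ℕ) : O)}} :=
    fun n => Ideal.finite_dvd _ (hne n)
  let F : ClassGroup O → Σ n : Finset.Icc 1 (4 * d.sqrt), {L : Ideal O // L ∣ Ideal.span {((n : ℕ) : O)}} :=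
    fun c => ⟨⟨Ideal.absNorm (J c), Finset.mem_Icc.mpr ⟨hpos c, hJN c⟩⟩,
      ⟨J c, Ideal.dvd_span_singleton.mpr (Ideal.absNorm_mem (J c))⟩⟩
  have hF : Function.Injective F := by
    intro c c' hcc
    have h1 : ∀ x y : Σ n : Finset.Icc 1 (4 * d.sqrt),
        {L : Ideal O // L ∣ Ideal.span {((n : ℕ) : O)}}, x = y → x.2.1 = y.2.1 := by
      rintro x y rfl; rfl
    have h2 : J c = J c' := h1 _ _ hcc
    rw [← hJc c, h2, hJc c']
  refine (Nat.card_le_card_of_injective F hF).trans ?_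
  rw [Nat.card_sigma, ← Finset.sum_coe_sort (Finset.Icc 1 (4 * d.sqrt)) fun n => n.divisors.card ^ 2]
  refine Finset.sum_le_sum fun n _ => ?_
  refine Ideal.card_dvd_span_natCast_le h.absNorm_span_intCast _ ?_
  have := (Finset.mem_Icc.mp n.2).1
  omega

end IsImaginaryQuadratic

/-- The norm equation satisfied by `d` when the classes of `∏_{p ∈ S} 𝔭` and `∏_{p ∈ T} 𝔭` in the
class group of `ℚ(√-d)` have the same `g`-th power. -/
def IsRepresented (g d : ℕ) (S T : Finset ℕ) : Prop :=
  ∃ u v : ℕ, 0 < v ∧ v.Coprime ((∏ p ∈ S \ T ∪ T \ S, p) ^ g) ∧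
    u ^ 2 + d * v ^ 2 = 4 * (∏ p ∈ S \ T ∪ T \ S, p) ^ g

open Classical in
/-- The number of pairs of distinct `r`-element sets of primes in `s` that represent `d`. -/
noncomputable def pairCount (g : ℕ) (s : Finset ℕ) (r d : ℕ) : ℕ :=
  ((s.powersetCard r ×ˢ s.powersetCard r).filter
    fun x => x.1 ≠ x.2 ∧ IsRepresented g d x.1 x.2).card

open Classical in
theorem sq_choose_le_two_mul_card_range_mul {G : Type*} [CommGroup G] [Finite G] (g : ℕ)
    (s : Finset ℕ) (f : ℕ → G) (r : ℕ)
    (hr : 2 * Nat.card (powMonoidHom g : G →* G).range ≤ s.card.choose r) :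
    s.card.choose r ^ 2 ≤ 2 * (Nat.card (powMonoidHom g : G →* G).range *
      ((s.powersetCard r ×ˢ s.powersetCard r).filter
        fun x => x.1 ≠ x.2 ∧ (∏ p ∈ x.1, f p) ^ g = (∏ p ∈ x.2, f p) ^ g).card) := by
  have := Fintype.ofFinite G
  set B : Finset G := Finset.univ.filter fun c => c ∈ (powMonoidHom g : G →* G).range with hB
  have hBcard : B.card = Nat.card (powMonoidHom g : G →* G).range := by
    rw [Nat.card_eq_fintype_card, Fintype.card_subtype]
  rw [← hBcard] at hr ⊢
  have h := sq_card_le_card_mul_card_pairs (s.powersetCard r) B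
    (fun S => (∏ p ∈ S, f p) ^ g) (fun S _ => by
      simp only [hB, Finset.mem_filter, Finset.mem_univ, true_and]
      exact ⟨∏ p ∈ S, f p, rfl⟩)
  rw [Finset.card_powersetCard] at h
  set F := (s.powersetCard r ×ˢ s.powersetCard r).filter
    fun x => (∏ p ∈ x.1, f p) ^ g = (∏ p ∈ x.2, f p) ^ g with hF
  have hsub : F ⊆ (s.powersetCard r ×ˢ s.powersetCard r).filter
      (fun x => x.1 ≠ x.2 ∧ (∏ p ∈ x.1, f p) ^ g = (∏ p ∈ x.2, f p) ^ g) ∪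
      (s.powersetCard r).diag := by
    intro x hx
    simp only [hF, Finset.mem_filter, Finset.mem_product, Finset.mem_union,
      Finset.mem_diag] at hx ⊢
    by_cases hxx : x.1 = x.2
    · exact Or.inr ⟨hx.1.1, hxx⟩
    · exact Or.inl ⟨hx.1, hxx, hx.2⟩
  have hle := (Finset.card_le_card hsub).trans (Finset.card_union_le _ _)
  rw [Finset.diag_card, Finset.card_powersetCard] at hle
  nlinarith [Nat.mul_le_mul_left B.card hle, Nat.mul_le_mul_right (s.card.choose r) hr]

open Classical in
theorem sq_card_torsion_le {G : Type*} [CommGroup G] [Finite G] (g : ℕ)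
    (s : Finset ℕ) (f : ℕ → G) (m : ℕ) (A : ℕ → ℝ) (hA : ∀ r ≤ m, 0 < A r)
    (hAs : ∀ r ≤ m, A r ≤ s.card.choose r) :
    (Nat.card {c : G // c ^ g = 1} : ℝ) ^ 2 ≤ 4 * (Nat.card G : ℝ) ^ 2 / A m ^ 2 +
      ∑ r ∈ Finset.range m, 4 * (Nat.card G : ℝ) ^ 2 / (A r * A (r + 1) ^ 2) *
        ((s.powersetCard (r + 1) ×ˢ s.powersetCard (r + 1)).filter
          fun x => x.1 ≠ x.2 ∧ (∏ p ∈ x.1, f p) ^ g = (∏ p ∈ x.2, f p) ^ g).card := by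
  set H := Nat.card (powMonoidHom g : G →* G).range with hH
  set t := Nat.card {c : G // c ^ g = 1} with ht
  have hth : (t : ℝ) * H = Nat.card G := by exact_mod_cast card_torsion_mul_card_range_pow (G := G) g
  have hH0 : (0 : ℝ) < H := by exact_mod_cast Nat.card_pos
  have ht0 : (0 : ℝ) ≤ t := by positivity
  set c : ℕ → ℕ := fun r => ((s.powersetCard r ×ˢ s.powersetCard r).filter
          fun x => x.1 ≠ x.2 ∧ (∏ p ∈ x.1, f p) ^ g = (∏ p ∈ x.2, f p) ^ g).card with hc
  change _ ≤ _ + ∑ r ∈ Finset.range m, 4 * (Nat.card G : ℝ) ^ 2 / (A r * A (r + 1) ^ 2) * c (r + 1)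
  rw [← hth]
  have key : ∀ n ≤ m, A n ≤ 2 * H ∨ (t : ℝ) ^ 2 ≤
      ∑ r ∈ Finset.range n, 4 * ((t : ℝ) * H) ^ 2 / (A r * A (r + 1) ^ 2) * c (r + 1) := by
    intro n
    induction n with
    | zero =>
      intro _
      left
      have h1 : (1 : ℝ) ≤ H := by exact_mod_cast Nat.card_pos
      have := hAs 0 (Nat.zero_le _)
      simp at this
      linarith
    | succ n ih =>
      intro hn
      have hAn := hA n (by omega)
      have hAn1 := hA (n + 1) hn
      have hterm : 0 ≤ 4 * ((t : ℝ) * H) ^ 2 / (A n * A (n + 1) ^ 2) * c (n + 1) := by positivity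
      rw [Finset.sum_range_succ]
      rcases ih (by omega) with h | h
      · by_cases h2 : A (n + 1) ≤ 2 * H
        · exact Or.inl h2
        · right
          push Not at h2
          have hsum : 0 ≤ ∑ r ∈ Finset.range n,
              4 * ((t : ℝ) * H) ^ 2 / (A r * A (r + 1) ^ 2) * c (r + 1) :=
            Finset.sum_nonneg fun r hr => by
              have := hA r (by have := Finset.mem_range.mp hr; omega)
              positivity
          refine le_trans ?_ (le_add_of_nonneg_left hsum)
          have hchoose := hAs (n + 1) hn
          have h3 := sq_choose_le_two_mul_card_range_mul g s f (n + 1)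
            (by exact_mod_cast h2.le.trans hchoose)
          have h3' : ((s.card.choose (n + 1) : ℕ) : ℝ) ^ 2 ≤ 2 * (H * c (n + 1)) := by
            exact_mod_cast h3
          have h4 : A (n + 1) ^ 2 ≤ 2 * (H * c (n + 1)) :=
            (pow_le_pow_left₀ hAn1.le hchoose 2).trans h3'
          rw [div_mul_eq_mul_div, le_div_iff₀ (by positivity)]
          have h5 : A n * A (n + 1) ^ 2 ≤ 2 * H * (2 * (H * c (n + 1))) :=
            mul_le_mul h h4 (by positivity) (by positivity)
          calc (t : ℝ) ^ 2 * (A n * A (n + 1) ^ 2)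
              ≤ (t : ℝ) ^ 2 * (2 * H * (2 * (H * c (n + 1)))) := by gcongr
            _ = _ := by ring
      · right
        linarith
  have hsum : 0 ≤ ∑ r ∈ Finset.range m,
      4 * ((t : ℝ) * H) ^ 2 / (A r * A (r + 1) ^ 2) * c (r + 1) :=
    Finset.sum_nonneg fun r hr => by
      have := Finset.mem_range.mp hr
      have := hA r (by omega)
      positivity
  have hAm := hA m le_rfl
  rcases key m le_rfl with h | h
  · refine le_trans ?_ (le_add_of_nonneg_right hsum)
    rw [le_div_iff₀ (by positivity)]
    calc (t : ℝ) ^ 2 * A m ^ 2 ≤ (t : ℝ) ^ 2 * (2 * H) ^ 2 := by gcongr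
      _ = _ := by ring
  · exact h.trans (le_add_of_nonneg_left (by positivity))

theorem isImaginaryQuadratic_Kneg (d : ℕ) (hd : Squarefree d) (hd0 : 0 < d) :
    ∃ (s : NumberField.RingOfIntegers (Kneg d))
      (σ : NumberField.RingOfIntegers (Kneg d) ≃+* NumberField.RingOfIntegers (Kneg d)),
      IsImaginaryQuadratic d s σ := by
  obtain ⟨s, σ, h1, h2, h3, h4⟩ := exists_sqrt_neg_and_conj d hd hd0
  exact ⟨s, σ, hd0, h1, h2, h3, h4⟩

theorem hneg_sq_le (g d m : ℕ) (hg : 0 < g) (hd : Squarefree d) (hd0 : 0 < d) (s : Finset ℕ)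
    (hs : ∀ p ∈ s, p.Prime ∧ 2 < p) (A : ℕ → ℝ) (hA : ∀ r ≤ m, 0 < A r)
    (hAs : ∀ r ≤ m, A r ≤ (Nat.card {p // p ∈ s ∧ IsResidue p (-d)}).choose r) (h : ℝ)
    (hh : (Nat.card (ClassGroup (NumberField.RingOfIntegers (Kneg d))) : ℝ) ≤ h) :
    (hneg g d : ℝ) ^ 2 ≤ 4 * h ^ 2 / A m ^ 2 +
      ∑ r ∈ Finset.range m, 4 * h ^ 2 / (A r * A (r + 1) ^ 2) * pairCount g s (r + 1) d := by
  classical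
  obtain ⟨x, σ, hq⟩ := isImaginaryQuadratic_Kneg d hd hd0
  set s' := s.filter fun p => IsResidue p (-d) with hs'
  have hcard : Nat.card {p // p ∈ s ∧ IsResidue p (-d)} = s'.card :=
    Nat.subtype_card s' fun p => by rw [hs', Finset.mem_filter]
  rw [hcard] at hAs
  have hsplit : ∀ p : ℕ, ∃ a b : Ideal (NumberField.RingOfIntegers (Kneg d)),
      p ∈ s' → IsSplitPair p a b := by
    intro p
    by_cases hp : p ∈ s'
    · have hp' := Finset.mem_filter.mp hp
      obtain ⟨a, b, hab⟩ := hq.exists_isSplitPair p (hs p hp'.1).1 (hs p hp'.1).2 hp'.2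
      exact ⟨a, b, fun _ => hab⟩
    · exact ⟨⊤, ⊤, fun h => absurd h hp⟩
  choose a b hab using hsplit
  refine (sq_card_torsion_le g s' (fun p => idealClass (a p)) m A hA hAs).trans ?_
  have hmono : ∀ r ∈ Finset.range m, 0 < A r ∧ 0 < A (r + 1) := fun r hr => by
    have := Finset.mem_range.mp hr
    exact ⟨hA r (by omega), hA (r + 1) (by omega)⟩
  refine add_le_add (by gcongr) (Finset.sum_le_sum fun r hr => ?_)
  obtain ⟨h1, h2⟩ := hmono r hr
  gcongr
  · refine Finset.card_le_card fun y hy => ?_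
    simp only [Finset.mem_filter, Finset.mem_product, Finset.mem_powersetCard] at hy ⊢
    obtain ⟨⟨⟨hS, hSc⟩, hT, hTc⟩, hne, heq⟩ := hy
    have hsub : s' ⊆ s := Finset.filter_subset _ _
    refine ⟨⟨⟨hS.trans hsub, hSc⟩, hT.trans hsub, hTc⟩, hne, ?_⟩
    have hmem : ∀ p ∈ y.1 ∪ y.2, p ∈ s' := fun p hp =>
      (Finset.mem_union.mp hp).elim (fun h => hS h) (fun h => hT h)
    exact hq.exists_represented_of_prod_eq g hg a b y.1 y.2 (fun p hp => hs p (hsub (hmem p hp)))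
      (fun p hp => hab p (hmem p hp)) hne heq

theorem card_divisors_sq_le (m c : ℕ) :
    ∃ C : ℕ, 1 ≤ C ∧ ∀ P n : ℕ, 1 ≤ P → n ≠ 0 → n ≤ c * P ^ m → n.divisors.card ^ 2 ≤ C * P := by
  obtain ⟨C, hC1, hC⟩ := card_divisors_pow_le (2 * (m + 1))
  refine ⟨C * (c + 1), Nat.mul_pos hC1 (Nat.succ_pos c), fun P n hP hn hle => ?_⟩
  refine le_of_pow_le_pow_left₀ (n := m + 1) (Nat.succ_ne_zero m) (Nat.zero_le _) ?_
  have h1 : 1 ≤ C * (c + 1) := Nat.mul_pos hC1 (Nat.succ_pos c)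
  calc (n.divisors.card ^ 2) ^ (m + 1) = n.divisors.card ^ (2 * (m + 1)) := (pow_mul _ _ _).symm
    _ ≤ C * n := hC n hn
    _ ≤ C * ((c + 1) * P ^ (m + 1)) := by
        refine Nat.mul_le_mul_left _ (hle.trans (Nat.mul_le_mul (Nat.le_succ c) ?_))
        exact Nat.pow_le_pow_right hP (Nat.le_succ m)
    _ = (C * (c + 1)) ^ 1 * P ^ (m + 1) := by ring
    _ ≤ (C * (c + 1)) ^ (m + 1) * P ^ (m + 1) :=
        Nat.mul_le_mul_right _ (Nat.pow_le_pow_right h1 (by omega))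
    _ = (C * (c + 1) * P) ^ (m + 1) := (mul_pow _ _ _).symm

/-- The bound `h(-d) ≪ d ^ (1 / 2 + o(1))`, on dyadic ranges of `d`. -/
theorem card_classGroup_Kneg_le (q : ℕ) :
    ∃ C : ℕ, ∀ P d : ℕ, 1 ≤ P → Squarefree d → 0 < d → d ≤ (2 * P) ^ (2 * q) →
      Nat.card (ClassGroup (NumberField.RingOfIntegers (Kneg d))) ≤ C * P ^ (q + 1) := by
  obtain ⟨C, -, hC⟩ := card_divisors_sq_le q (4 * 2 ^ q)
  refine ⟨4 * 2 ^ q * C, fun P d hP hd hd0 hle => ?_⟩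
  obtain ⟨s, σ, h⟩ := isImaginaryQuadratic_Kneg d hd hd0
  have hsqrt : 4 * d.sqrt ≤ 4 * 2 ^ q * P ^ q := by
    rw [mul_assoc, ← mul_pow]
    refine Nat.mul_le_mul_left _ ((Nat.sqrt_le_sqrt hle).trans_eq ?_)
    rw [mul_comm 2 q, pow_mul]
    exact Nat.sqrt_eq' _
  calc _ ≤ _ := h.card_classGroup_le
    _ ≤ ∑ n ∈ Finset.Icc 1 (4 * d.sqrt), C * P := Finset.sum_le_sum fun n hn => by
        rw [Finset.mem_Icc] at hn
        exact hC P n hP (by omega) (hn.2.trans hsqrt)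
    _ = 4 * d.sqrt * (C * P) := by simp
    _ ≤ 4 * 2 ^ q * P ^ q * (C * P) := Nat.mul_le_mul_right _ hsqrt
    _ = _ := by ring

theorem exists_mul_pow_le_choose (r c : ℕ) :
    ∃ a : ℝ, 0 < a ∧ ∀ P N : ℕ, 2 ≤ P → P.primeCounting ≤ c * N → 2 * r ≤ N →
      a * P ^ r / P ≤ N.choose r := by
  obtain ⟨C, hC1, hC⟩ := pow_le_mul_primeCounting_pow r
  refine ⟨1 / (C * (2 * (c + 1)) ^ r * r.factorial), by positivity, fun P N hP hN hr => ?_⟩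
  have hC0 : (0 : ℝ) < C := by exact_mod_cast hC1
  have hP0 : (0 : ℝ) < P := by positivity
  have h1 : (P : ℝ) ^ r ≤ C * P * (P.primeCounting : ℝ) ^ r := by exact_mod_cast hC P hP
  have h2 := Nat.pow_le_choose (α := ℝ) r N
  have h3 : (P.primeCounting : ℝ) ≤ 2 * (c + 1) * ((N + 1 - r : ℕ) : ℝ) := by
    have : P.primeCounting ≤ 2 * (c + 1) * (N + 1 - r) := by
      have : N ≤ 2 * (N + 1 - r) := by omega
      nlinarith
    exact_mod_cast this
  refine le_trans ?_ h2
  rw [div_le_iff₀ hP0, div_mul_eq_mul_div, div_mul_eq_mul_div, div_le_div_iff₀ (by positivity)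
    (by positivity), one_mul]
  calc (P : ℝ) ^ r * r.factorial ≤ C * P * (P.primeCounting : ℝ) ^ r * r.factorial := by gcongr
    _ ≤ C * P * (2 * (c + 1) * ((N + 1 - r : ℕ) : ℝ)) ^ r * r.factorial := by gcongr
    _ = _ := by rw [mul_pow]; ring

theorem exists_finset_primes (P : ℕ) (hP : 12 ≤ P.primeCounting) :
    ∃ (s : Finset ℕ) (R : ℕ), 0 < R ∧ (∀ p ∈ s, p.Prime ∧ 2 < p ∧ R ≤ p ∧ p ≤ P) ∧
      s.card ≤ 3 * R ∧ P.primeCounting ≤ 2 * s.card := by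
  set n := P.primeCounting with hn
  have hcard : ((Finset.Icc 1 P).filter Nat.Prime).card = n := by
    rw [hn, Nat.primeCounting, Nat.primeCounting', Nat.count_eq_card_filter_range]
    congr 1
    ext p
    simp only [Finset.mem_filter, Finset.mem_Icc, Finset.mem_range]
    constructor
    · rintro ⟨h, hp⟩
      exact ⟨by omega, hp⟩
    · rintro ⟨h, hp⟩
      exact ⟨⟨hp.one_le, by omega⟩, hp⟩
  set R := n / 3 + 1 with hR
  set s := ((Finset.Icc 1 P).filter Nat.Prime).filter fun p => R ≤ p with hs
  have hle : n ≤ s.card + R := by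
    rw [← hcard, ← Finset.card_filter_add_card_filter_not (fun p => R ≤ p)]
    refine Nat.add_le_add_left ?_ _
    calc _ ≤ (Finset.range R).card := Finset.card_le_card fun p hp => by
          simpa using (Finset.mem_filter.mp hp).2
      _ = R := Finset.card_range R
  have hle' : s.card ≤ n := by rw [← hcard]; exact Finset.card_filter_le _ _
  refine ⟨s, R, by omega, fun p hp => ?_, by omega, by omega⟩
  simp only [hs, Finset.mem_filter, Finset.mem_Icc] at hp
  exact ⟨hp.1.2, by omega, hp.2, hp.1.1.2⟩

theorem sum_pairCount_le (g q r : ℕ) :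
    ∃ C : ℝ, 0 ≤ C ∧ ∀ (P : ℕ) (s T : Finset ℕ), 1 ≤ P → (∀ p ∈ s, 1 ≤ p ∧ p ≤ P) →
      (∀ d ∈ T, P ^ (2 * q) ≤ d ∧ d ≤ (2 * P) ^ (2 * q)) →
      ∑ d ∈ T, (pairCount g s r d : ℝ) ≤
        C * (P : ℝ) ^ (2 * r + 1) * ((P : ℝ) ^ q + (P : ℝ) ^ (r * g) / (P : ℝ) ^ q) := by
  classical
  obtain ⟨C, -, hC⟩ := card_divisors_sq_le (2 * r * g) 4
  refine ⟨C * (4 * 4 ^ q + 2), by positivity, fun P s T hP hs hT => ?_⟩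
  have hP0 : (0 : ℝ) < P := by exact_mod_cast hP
  have hscard : s.card ≤ P := by
    calc s.card ≤ (Finset.Icc 1 P).card :=
          Finset.card_le_card fun p hp => Finset.mem_Icc.mpr (hs p hp)
      _ = P := by simp
  have hpow : (s.powersetCard r).card ≤ P ^ r := by
    rw [Finset.card_powersetCard]
    exact (Nat.choose_le_pow _ _).trans (Nat.pow_le_pow_left hscard r)
  have hpair : ∀ x ∈ s.powersetCard r ×ˢ s.powersetCard r,
      ((T.filter fun d => x.1 ≠ x.2 ∧ IsRepresented g d x.1 x.2).card : ℝ) ≤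
        C * P * (4 * 4 ^ q * (P : ℝ) ^ q + 2 * (P : ℝ) ^ (r * g) / (P : ℝ) ^ q) := by
    intro x hx
    simp only [Finset.mem_product, Finset.mem_powersetCard] at hx
    obtain ⟨⟨hS, hSc⟩, hU, hUc⟩ := hx
    set W := x.1 \ x.2 ∪ x.2 \ x.1 with hW
    set M := (∏ p ∈ W, p) ^ g with hM
    have hWs : ∀ p ∈ W, p ∈ s := fun p hp => by
      simp only [hW, Finset.mem_union, Finset.mem_sdiff] at hp
      exact hp.elim (fun h => hS h.1) (fun h => hU h.1)
    have hWcard : W.card ≤ 2 * r := by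
      calc W.card ≤ (x.1 \ x.2).card + (x.2 \ x.1).card := Finset.card_union_le _ _
        _ ≤ x.1.card + x.2.card :=
          add_le_add (Finset.card_le_card Finset.sdiff_subset)
            (Finset.card_le_card Finset.sdiff_subset)
        _ = 2 * r := by omega
    have hM0 : 0 < M := pow_pos (Finset.prod_pos fun p hp => (hs p (hWs p hp)).1) g
    have hMle : M ≤ P ^ (2 * r * g) := by
      rw [hM, pow_mul]
      refine Nat.pow_le_pow_left ?_ g
      calc ∏ p ∈ W, p ≤ ∏ p ∈ W, P := Finset.prod_le_prod' fun p hp => (hs p (hWs p hp)).2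
        _ = P ^ W.card := by simp
        _ ≤ P ^ (2 * r) := Nat.pow_le_pow_right hP hWcard
    have hτ : ∀ v : ℕ, 0 < v → v ^ 2 ≤ 4 * M → (v ^ 2).divisors.card ≤ C * P := fun v hv hvM =>
      (Nat.le_self_pow two_ne_zero _).trans
        (hC P (v ^ 2) hP (by positivity) (hvM.trans (Nat.mul_le_mul_left 4 hMle)))
    have h := card_represented_le M (P ^ (2 * q)) ((2 * P) ^ (2 * q)) (C * P) hM0
      (pow_pos hP _) hτ (T.filter fun d => x.1 ≠ x.2 ∧ IsRepresented g d x.1 x.2)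
      (fun d hd => by
        rw [Finset.mem_filter] at hd
        exact ⟨(hT d hd.1).1, (hT d hd.1).2, hd.2.2⟩)
    have hsqP : √((P ^ (2 * q) : ℕ) : ℝ) = (P : ℝ) ^ q := by
      rw [Nat.cast_pow, mul_comm, pow_mul]
      exact Real.sqrt_sq (by positivity)
    have hsqM : √(M : ℝ) ≤ (P : ℝ) ^ (r * g) := by
      refine Real.sqrt_le_iff.mpr ⟨by positivity, ?_⟩
      rw [← pow_mul, show r * g * 2 = 2 * r * g by ring]
      exact_mod_cast hMle
    rw [hsqP] at h
    refine h.trans ?_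
    push_cast
    have h4 : 4 * (2 * (P : ℝ)) ^ (2 * q) / (P : ℝ) ^ q = 4 * 4 ^ q * (P : ℝ) ^ q := by
      rw [div_eq_iff (by positivity), mul_pow, pow_mul, pow_mul]
      norm_num
      rw [← pow_mul]
      ring
    rw [h4]
    gcongr
  calc ∑ d ∈ T, (pairCount g s r d : ℝ)
      = ∑ x ∈ s.powersetCard r ×ˢ s.powersetCard r,
          ((T.filter fun d => x.1 ≠ x.2 ∧ IsRepresented g d x.1 x.2).card : ℝ) := by
        simp only [pairCount, Finset.card_filter, Nat.cast_sum]
        exact Finset.sum_comm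
    _ ≤ ∑ x ∈ s.powersetCard r ×ˢ s.powersetCard r,
          C * P * (4 * 4 ^ q * (P : ℝ) ^ q + 2 * (P : ℝ) ^ (r * g) / (P : ℝ) ^ q) :=
        Finset.sum_le_sum hpair
    _ = ((s.powersetCard r).card : ℝ) * (s.powersetCard r).card *
          (C * P * (4 * 4 ^ q * (P : ℝ) ^ q + 2 * (P : ℝ) ^ (r * g) / (P : ℝ) ^ q)) := by
        rw [Finset.sum_const, Finset.card_product, nsmul_eq_mul]
        push_cast
        ring
    _ ≤ (P : ℝ) ^ r * (P : ℝ) ^ r *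
          (C * P * ((4 * 4 ^ q + 2) * ((P : ℝ) ^ q + (P : ℝ) ^ (r * g) / (P : ℝ) ^ q))) := by
        have hpow' : ((s.powersetCard r).card : ℝ) ≤ (P : ℝ) ^ r := by exact_mod_cast hpow
        gcongr
        have h1 : 0 ≤ (P : ℝ) ^ (r * g) / (P : ℝ) ^ q := by positivity
        have h2 : 0 ≤ (4 : ℝ) ^ q * ((P : ℝ) ^ (r * g) / (P : ℝ) ^ q) := by positivity
        have h3 : 0 ≤ (P : ℝ) ^ q := by positivity
        rw [mul_div_assoc]
        nlinarith
    _ = _ := by ring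

theorem mul_pow_div_mul_le {x a b c D : ℝ} (hx : 1 ≤ x) (ha : 0 < a) (hb : 0 < b) (hD : 0 ≤ D)
    {g q E r : ℕ} (h1 : 3 * q ≤ E) (h2 : (r + 1) * g + q ≤ E + r + 1) :
    4 * (c * x ^ (q + 1)) ^ 2 / ((a * x ^ r / x) * (b * x ^ (r + 1) / x) ^ 2) *
      (D * x ^ (2 * (r + 1) + 1) * (x ^ q + x ^ ((r + 1) * g) / x ^ q)) ≤
    8 * c ^ 2 * D / (a * b ^ 2) * x ^ (E + 7) := by
  have hx0 : 0 < x := by linarith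
  have h3 : x ^ q + x ^ ((r + 1) * g) / x ^ q ≤ 2 * x ^ (E + r + 1) / x ^ (2 * q) := by
    have e1 : x ^ q = x ^ (3 * q) / x ^ (2 * q) := by
      rw [eq_div_iff (by positivity), ← pow_add]
      congr 1
      omega
    have e2 : x ^ ((r + 1) * g) / x ^ q = x ^ ((r + 1) * g + q) / x ^ (2 * q) := by
      rw [div_eq_div_iff (by positivity) (by positivity), ← pow_add, ← pow_add]
      congr 1
      omega
    rw [e2]
    nth_rewrite 1 [e1]
    rw [← add_div]
    gcongr
    rw [two_mul]
    exact add_le_add (pow_le_pow_right₀ hx (by omega)) (pow_le_pow_right₀ hx h2)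
  calc _ ≤ 4 * (c * x ^ (q + 1)) ^ 2 / ((a * x ^ r / x) * (b * x ^ (r + 1) / x) ^ 2) *
      (D * x ^ (2 * (r + 1) + 1) * (2 * x ^ (E + r + 1) / x ^ (2 * q))) := by gcongr
    _ = _ := by
      field_simp
      ring

/-- The sum of `h_g(-d) ^ 2` over a dyadic range of `d`. -/
theorem sum_sq_hneg_dyadic_le_of_le (g k : ℕ) (hg5 : 5 ≤ g) (hk : 1 ≤ k) :
    ∃ (C : ℝ) (P₀ : ℕ), ∀ P : ℕ, P₀ ≤ P →
      ∑ d ∈ (Finset.Ico (P ^ (2 * ((g + 1) * k))) ((2 * P) ^ (2 * ((g + 1) * k)))).filter Squarefree,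
        (hneg g d : ℝ) ^ 2 ≤ C * (P : ℝ) ^ ((4 * g - 2) * k + 7) := by
  classical
  set q := (g + 1) * k with hq
  set E := (4 * g - 2) * k with hE
  have hqk : k ≤ q := Nat.le_mul_of_pos_left k (Nat.succ_pos g)
  have hE6 : E + 6 * k = 4 * q := by
    rw [hE, hq, ← add_mul, show 4 * g - 2 + 6 = 4 * (g + 1) by omega, mul_assoc]
  have hE3 : 3 * q ≤ E := by
    have : 6 * k ≤ q := Nat.mul_le_mul_right k (by omega)
    omega
  have hEr : ∀ r < 3 * k, (r + 1) * g + q ≤ E + r + 1 := by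
    intro r hr
    obtain ⟨t, rfl⟩ : ∃ t, g = t + 1 := ⟨g - 1, by omega⟩
    have : (r + 1) * t ≤ 3 * k * t := Nat.mul_le_mul_right t hr
    have h4 : 4 * q = 4 * (k * t) + 8 * k := by rw [hq]; ring
    have h5 : 3 * k * t = 3 * (k * t) := by ring
    have h6 : (r + 1) * (t + 1) = (r + 1) * t + (r + 1) := by ring
    omega
  obtain ⟨c, hc⟩ := card_classGroup_Kneg_le q
  choose a ha0 ha using fun r => exists_mul_pow_le_choose r (8 * q)
  choose D hD0 hD using fun r => sum_pairCount_le g q r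
  obtain ⟨b, hb0, hb⟩ := exists_mul_pow_le_choose q 2
  obtain ⟨P₀, hP₀⟩ := Filter.eventually_atTop.mp
    (Nat.tendsto_primeCounting.eventually_ge_atTop (48 * q * k + 12))
  refine ⟨(336 * 8 ^ q * 4 ^ q / b + 8 * 4 ^ q) * c ^ 2 + (4 * c ^ 2 * 4 ^ q / a (3 * k) ^ 2 +
    ∑ r ∈ Finset.range (3 * k), 8 * (c : ℝ) ^ 2 * D (r + 1) / (a r * a (r + 1) ^ 2)),
    max P₀ 2, fun P hP => ?_⟩
  have hP2 : 2 ≤ P := (le_max_right _ _).trans hP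
  have hx : (1 : ℝ) ≤ P := by exact_mod_cast one_le_two.trans hP2
  have hx0 : (0 : ℝ) < P := by linarith
  have hπ := hP₀ P ((le_max_left _ _).trans hP)
  obtain ⟨s, R, hR, hs, hsR, hsM⟩ := exists_finset_primes P (by omega)
  have hqk1 : q ≤ q * k := Nat.le_mul_of_pos_right q hk
  have hqqk : 24 * (q * k) ≤ s.card := by
    have : 48 * q * k = 48 * (q * k) := by ring
    omega
  set T := (Finset.Ico (P ^ (2 * q)) ((2 * P) ^ (2 * q))).filter Squarefree with hT
  have hTmem : ∀ d ∈ T, P ^ (2 * q) ≤ d ∧ d ≤ (2 * P) ^ (2 * q) ∧ Squarefree d ∧ 0 < d := by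
    intro d hd
    rw [hT, Finset.mem_filter, Finset.mem_Ico] at hd
    exact ⟨hd.1.1, hd.1.2.le, hd.2, Nat.pos_of_ne_zero hd.2.ne_zero⟩
  have hh : ∀ d ∈ T, (Nat.card (ClassGroup (NumberField.RingOfIntegers (Kneg d))) : ℝ) ≤
      c * (P : ℝ) ^ (q + 1) := by
    intro d hd
    obtain ⟨-, h2, h3, h4⟩ := hTmem d hd
    exact_mod_cast hc P d (by omega) h3 h4 h2
  have hcardT : (T.card : ℝ) ≤ 4 ^ q * (P : ℝ) ^ (2 * q) := by
    have : T.card ≤ (2 * P) ^ (2 * q) :=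
      (Finset.card_filter_le _ _).trans (by rw [Nat.card_Ico]; exact Nat.sub_le _ _)
    calc (T.card : ℝ) ≤ ((2 * P) ^ (2 * q) : ℕ) := by exact_mod_cast this
      _ = _ := by push_cast; rw [mul_pow, pow_mul]; norm_num
  set bad : ℕ → Prop := fun d => 4 * q * Nat.card {p // p ∈ s ∧ IsResidue p (-d)} ≤ s.card
    with hbad
  have hsumbad : ∑ d ∈ T.filter bad, (hneg g d : ℝ) ^ 2 ≤
      (336 * 8 ^ q * 4 ^ q / b + 8 * 4 ^ q) * c ^ 2 * (P : ℝ) ^ (E + 7) := by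
    have hcard := card_le_of_few_residues s P R q ((2 * P) ^ (2 * q)) hR hs hsR (by omega)
      (by omega) (by positivity) (T.filter bad) (fun d hd => by
        rw [Finset.mem_filter] at hd
        exact ⟨(hTmem d hd.1).2.1, hd.2⟩)
    have hchoose := hb P s.card hP2 hsM (by omega)
    have hcard' : ((T.filter bad).card : ℝ) ≤
        (336 * 8 ^ q * 4 ^ q / b + 8 * 4 ^ q) * (P : ℝ) ^ (q + 1) := by
      refine hcard.trans ?_
      rw [add_mul]
      refine add_le_add ?_ ?_
      · calc _ ≤ 336 * 8 ^ q * (((2 * P) ^ (2 * q) : ℕ) : ℝ) / (b * (P : ℝ) ^ q / P) := by gcongr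
          _ = _ := by
            push_cast
            rw [mul_pow, pow_mul 2 2 q, mul_comm 2 q, pow_mul (P : ℝ) q 2]
            field_simp
            norm_num
            ring
      · rw [mul_pow, ← mul_assoc]
        gcongr
        omega
    calc ∑ d ∈ T.filter bad, (hneg g d : ℝ) ^ 2
        ≤ ∑ d ∈ T.filter bad, (c * (P : ℝ) ^ (q + 1)) ^ 2 := by
          refine Finset.sum_le_sum fun d hd => ?_
          have hle : (hneg g d : ℝ) ≤ c * (P : ℝ) ^ (q + 1) := by
            refine le_trans ?_ (hh d (Finset.mem_filter.mp hd).1)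
            exact_mod_cast Finite.card_subtype_le _
          gcongr
      _ = (T.filter bad).card * (c * (P : ℝ) ^ (q + 1)) ^ 2 := by simp
      _ ≤ (336 * 8 ^ q * 4 ^ q / b + 8 * 4 ^ q) * (P : ℝ) ^ (q + 1) *
            (c * (P : ℝ) ^ (q + 1)) ^ 2 := by gcongr
      _ = (336 * 8 ^ q * 4 ^ q / b + 8 * 4 ^ q) * c ^ 2 * (P : ℝ) ^ (3 * q + 3) := by ring
      _ ≤ _ := by
          gcongr
          omega
  have hsumgood : ∑ d ∈ T.filter (fun d => ¬ bad d), (hneg g d : ℝ) ^ 2 ≤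
      (4 * c ^ 2 * 4 ^ q / a (3 * k) ^ 2 + ∑ r ∈ Finset.range (3 * k),
        8 * (c : ℝ) ^ 2 * D (r + 1) / (a r * a (r + 1) ^ 2)) * (P : ℝ) ^ (E + 7) := by
    set A : ℕ → ℝ := fun r => a r * (P : ℝ) ^ r / P with hA
    have hA0 : ∀ r, 0 < A r := fun r => by have := ha0 r; positivity
    have hpt : ∀ d ∈ T.filter (fun d => ¬ bad d), (hneg g d : ℝ) ^ 2 ≤
        4 * (c * (P : ℝ) ^ (q + 1)) ^ 2 / A (3 * k) ^ 2 + ∑ r ∈ Finset.range (3 * k),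
          4 * (c * (P : ℝ) ^ (q + 1)) ^ 2 / (A r * A (r + 1) ^ 2) * pairCount g s (r + 1) d := by
      intro d hd
      rw [Finset.mem_filter] at hd
      have hgood : s.card < 4 * q * Nat.card {p // p ∈ s ∧ IsResidue p (-d)} := not_le.mp hd.2
      obtain ⟨-, -, h3, h4⟩ := hTmem d hd.1
      refine hneg_sq_le g d (3 * k) (by omega) h3 h4 s (fun p hp => ⟨(hs p hp).1, (hs p hp).2.1⟩) A
        (fun r _ => hA0 r) (fun r hr => ?_) _ (hh d hd.1)
      refine ha r P _ hP2 ?_ ?_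
      · calc _ ≤ _ := hsM
          _ ≤ 2 * (4 * q * Nat.card {p // p ∈ s ∧ IsResidue p (-d)}) :=
            Nat.mul_le_mul_left 2 hgood.le
          _ = _ := by ring
      · have h5 : 4 * q * (6 * k) ≤ 4 * q * Nat.card {p // p ∈ s ∧ IsResidue p (-d)} := by
          refine le_trans ?_ hgood.le
          calc 4 * q * (6 * k) = 24 * (q * k) := by ring
            _ ≤ _ := hqqk
        have := Nat.le_of_mul_le_mul_left h5 (by omega)
        omega
    calc _ ≤ _ := Finset.sum_le_sum hpt
      _ ≤ ∑ d ∈ T, (4 * (c * (P : ℝ) ^ (q + 1)) ^ 2 / A (3 * k) ^ 2 + ∑ r ∈ Finset.range (3 * k),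
            4 * (c * (P : ℝ) ^ (q + 1)) ^ 2 / (A r * A (r + 1) ^ 2) *
              pairCount g s (r + 1) d) := by
          refine Finset.sum_le_sum_of_subset_of_nonneg (Finset.filter_subset _ _) fun d _ _ => ?_
          refine add_nonneg (by positivity) (Finset.sum_nonneg fun r _ => ?_)
          have := hA0 r
          positivity
      _ = T.card * (4 * (c * (P : ℝ) ^ (q + 1)) ^ 2 / A (3 * k) ^ 2) +
          ∑ r ∈ Finset.range (3 * k), 4 * (c * (P : ℝ) ^ (q + 1)) ^ 2 / (A r * A (r + 1) ^ 2) *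
            ∑ d ∈ T, (pairCount g s (r + 1) d : ℝ) := by
          rw [Finset.sum_add_distrib, Finset.sum_comm]
          simp [Finset.mul_sum]
      _ ≤ _ := by
          rw [add_mul, Finset.sum_mul]
          refine add_le_add ?_ (Finset.sum_le_sum fun r hr => ?_)
          · calc _ ≤ 4 ^ q * (P : ℝ) ^ (2 * q) *
                  (4 * (c * (P : ℝ) ^ (q + 1)) ^ 2 / A (3 * k) ^ 2) := by gcongr
              _ = 4 * c ^ 2 * 4 ^ q / a (3 * k) ^ 2 * (P : ℝ) ^ (E + 4) := by
                have h6 : (P : ℝ) ^ (2 * q) * ((P : ℝ) ^ (q + 1)) ^ 2 * (P : ℝ) ^ 2 =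
                    (P : ℝ) ^ (E + 4) * ((P : ℝ) ^ (3 * k)) ^ 2 := by
                  rw [← pow_mul, ← pow_mul, ← pow_add, ← pow_add, ← pow_add]
                  congr 1
                  omega
                have := ha0 (3 * k)
                simp only [hA]
                rw [div_pow, mul_pow, mul_pow]
                field_simp
                linear_combination (c : ℝ) ^ 2 * h6
              _ ≤ _ := by
                gcongr
                omega
          · have hr' := Finset.mem_range.mp hr
            refine le_trans ?_ (mul_pow_div_mul_le hx (ha0 r) (ha0 (r + 1)) (hD0 (r + 1)) hE3
              (hEr r hr'))
            have := hA0 r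
            refine mul_le_mul_of_nonneg_left ?_ (by positivity)
            exact hD (r + 1) P s T (by omega)
              (fun p hp => ⟨(hs p hp).1.one_le, (hs p hp).2.2.2⟩)
              (fun d hd => ⟨(hTmem d hd).1, (hTmem d hd).2.1⟩)
  rw [← Finset.sum_filter_add_sum_filter_not T bad, add_mul]
  exact add_le_add hsumbad hsumgood

theorem sum_sq_hneg_dyadic_le (g k : ℕ) (hg5 : 5 ≤ g) (hk : 1 ≤ k) :
    ∃ C : ℝ, 0 < C ∧ ∀ P : ℕ, 1 ≤ P →
      ∑ d ∈ (Finset.Ico (P ^ (2 * ((g + 1) * k))) ((2 * P) ^ (2 * ((g + 1) * k)))).filter Squarefree,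
        (hneg g d : ℝ) ^ 2 ≤ C * (P : ℝ) ^ ((4 * g - 2) * k + 7) := by
  obtain ⟨C, P₀, hC⟩ := sum_sq_hneg_dyadic_le_of_le g k hg5 hk
  set C₀ : ℝ := ∑ d ∈ Finset.range ((2 * P₀) ^ (2 * ((g + 1) * k))), (hneg g d : ℝ) ^ 2 with hC₀
  have hC₀0 : 0 ≤ C₀ := Finset.sum_nonneg fun _ _ => by positivity
  refine ⟨|C| + C₀ + 1, by positivity, fun P hP => ?_⟩
  have hx : (1 : ℝ) ≤ (P : ℝ) ^ ((4 * g - 2) * k + 7) := one_le_pow₀ (by exact_mod_cast hP)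
  rcases le_or_gt P₀ P with h | h
  · refine (hC P h).trans ?_
    gcongr
    linarith [le_abs_self C]
  · refine le_trans ?_ (le_mul_of_one_le_right (by positivity) hx)
    refine le_trans (b := C₀) ?_ (by linarith [abs_nonneg C])
    refine Finset.sum_le_sum_of_subset_of_nonneg (fun d hd => ?_) fun _ _ _ => by positivity
    rw [Finset.mem_filter, Finset.mem_Ico] at hd
    exact Finset.mem_range.mpr (hd.1.2.trans_le (Nat.pow_le_pow_left (by omega) _))

theorem sum_pow_le_two_mul_pow {x : ℝ} (hx : 2 ≤ x) (L : ℕ) :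
    ∑ i ∈ Finset.range (L + 1), x ^ i ≤ 2 * x ^ L := by
  induction L with
  | zero => norm_num
  | succ L ih =>
    rw [Finset.sum_range_succ]
    have h : 2 * x ^ L ≤ x ^ (L + 1) := by
      rw [pow_succ, mul_comm]
      gcongr
    linarith

/-- For each prime `g ≥ 5` and every `ε > 0` there is `C = C(g, ε)` such that
for all `X ≥ 2`,
`∑_{0 < d < X, d squarefree} h_g(-d)^2 ≤ C · X^(2 - 3/(g+1) + ε)`. -/
theorem second_moment_hg_bound (g : ℕ) (hg : g.Prime) (hg5 : 5 ≤ g)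
    (ε : ℝ) (hε : 0 < ε) :
    ∃ C : ℝ, 0 < C ∧ ∀ X : ℝ, 2 ≤ X →
      ∑ d ∈ (Finset.range (⌈X⌉₊ + 1)).filter
          (fun d : ℕ => Squarefree d ∧ 0 < d ∧ (d : ℝ) < X),
        (hneg g d : ℝ) ^ 2
      ≤ C * X ^ (2 - 3 / ((g : ℝ) + 1) + ε) := by
  set k := ⌈7 / ε⌉₊ + 1 with hk
  have hkε : 7 / ε ≤ k := by
    rw [hk]
    push_cast
    exact (Nat.le_ceil _).trans (by linarith)
  obtain ⟨C, hC0, hC⟩ := sum_sq_hneg_dyadic_le g k hg5 (by omega)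
  set K := 2 * ((g + 1) * k) with hK
  set E := (4 * g - 2) * k + 7 with hE
  have hK0 : 0 < K := by positivity
  have hexp : (E : ℝ) / K ≤ 2 - 3 / ((g : ℝ) + 1) + ε := by
    have hE' : (E : ℝ) = (4 * g - 2) * k + 7 := by
      rw [hE]
      push_cast [Nat.cast_sub (show 2 ≤ 4 * g by omega)]
      ring
    have hk0 : (0 : ℝ) < k := by rw [hk]; positivity
    have hkε' : 7 ≤ ε * k := by rwa [div_le_iff₀' hε] at hkε
    rw [div_le_iff₀ (by exact_mod_cast hK0), hE', hK]
    push_cast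
    have h1 : (2 - 3 / ((g : ℝ) + 1) + ε) * (2 * ((g + 1) * k)) =
        (4 * g - 2) * k + 2 * (g + 1) * (ε * k) := by
      field_simp
      ring
    rw [h1]
    have : (0 : ℝ) ≤ g := by positivity
    nlinarith
  refine ⟨2 * C, by positivity, fun X hX => ?_⟩
  have hX0 : (0 : ℝ) ≤ X := by linarith
  set S := (Finset.range (⌈X⌉₊ + 1)).filter
    (fun d : ℕ => Squarefree d ∧ 0 < d ∧ (d : ℝ) < X) with hS
  have hb : 1 < 2 ^ K := Nat.one_lt_two_pow hK0.ne'
  set L := Nat.log (2 ^ K) ⌊X⌋₊ with hL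
  have hmaps : ∀ d ∈ S, Nat.log (2 ^ K) d ∈ Finset.range (L + 1) := by
    intro d hd
    rw [hS, Finset.mem_filter] at hd
    exact Finset.mem_range_succ_iff.mpr (Nat.log_mono_right (Nat.le_floor hd.2.2.2.le))
  have hfloor : ⌊X⌋₊ ≠ 0 := (Nat.floor_pos.mpr (by linarith)).ne'
  have hLX : ((2 : ℝ) ^ L) ^ K ≤ X := by
    have h1 := Nat.pow_log_le_self (2 ^ K) hfloor
    rw [pow_right_comm] at h1
    have h2 : (((2 ^ L) ^ K : ℕ) : ℝ) ≤ ⌊X⌋₊ := by exact_mod_cast h1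
    push_cast at h2
    exact h2.trans (Nat.floor_le hX0)
  have hblock : ∀ i, ∑ d ∈ S.filter (fun d => Nat.log (2 ^ K) d = i), (hneg g d : ℝ) ^ 2 ≤
      C * ((2 : ℝ) ^ E) ^ i := by
    intro i
    have h := hC (2 ^ i) Nat.one_le_two_pow
    rw [Nat.cast_pow, Nat.cast_two, pow_right_comm (2 : ℝ) i E] at h
    refine le_trans (Finset.sum_le_sum_of_subset_of_nonneg (fun d hd => ?_)
      fun _ _ _ => by positivity) h
    rw [Finset.mem_filter, hS, Finset.mem_filter] at hd
    obtain ⟨⟨-, hsq, hd0, -⟩, rfl⟩ := hd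
    rw [Finset.mem_filter, Finset.mem_Ico]
    refine ⟨⟨?_, ?_⟩, hsq⟩
    · rw [pow_right_comm]
      exact Nat.pow_log_le_self _ hd0.ne'
    · rw [← pow_succ', pow_right_comm]
      exact Nat.lt_pow_succ_log_self hb d
  have hE2 : (2 : ℝ) ≤ 2 ^ E := le_self_pow₀ one_le_two (by omega)
  calc ∑ d ∈ S, (hneg g d : ℝ) ^ 2
      = ∑ i ∈ Finset.range (L + 1), ∑ d ∈ S.filter (fun d => Nat.log (2 ^ K) d = i),
          (hneg g d : ℝ) ^ 2 := (Finset.sum_fiberwise_of_maps_to hmaps _).symm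
    _ ≤ ∑ i ∈ Finset.range (L + 1), C * ((2 : ℝ) ^ E) ^ i :=
        Finset.sum_le_sum fun i _ => hblock i
    _ ≤ C * (2 * ((2 : ℝ) ^ E) ^ L) := by
        rw [← Finset.mul_sum]
        gcongr
        exact sum_pow_le_two_mul_pow hE2 L
    _ = 2 * C * (((2 : ℝ) ^ L) ^ K) ^ ((E : ℝ) / K) := by
        rw [← Real.rpow_natCast (2 ^ L) K, ← Real.rpow_mul (by positivity),
          mul_div_cancel₀ _ (by positivity), Real.rpow_natCast, pow_right_comm]
        ring
    _ ≤ 2 * C * X ^ ((E : ℝ) / K) := by gcongr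
    _ ≤ _ := by
        gcongr
        linarith
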